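/- arXiv:2112.09746 — 2 statements merged into one kernel-verified Lean document; each statement's English description precedes it below -/
import Mathlib

section
/- (2,∞)-norm estimation bound and cluster recovery for CRL. Let l0(·;Y) be differentiable and μ-strongly convex, B* ∈ ℝ^{p×m} with r* = rank(B*), q* = ‖B*‖_{2,C} > 1, and assume the effective noise E = −∇l0(XB*;Y) has vec(E) sub-Gaussian with mean zero and scale bounded by σ. Suppose for some δ > 0 that ‖X B‖_F²/n ≥ δ ‖B‖_{2,∞}² for all B with rank(B) ≤ (1+ϑ) r* and ‖B‖_{2,C} ≤ ϑ q*², where ϑ ≥ 1, and let B̂ be a global minimizer of l0(XB;Y) over {B : ‖B‖_{2,C} ≤ ϑ q*, rank(B) ≤ ϑ r*}. Then there exist constants c₀, c, C > 0 such that, with probability at least 1 − C exp{−c (m + rank(X))}, ‖B̂ − B*‖_{2,∞}² ≤ (c₀ ϑ² σ² / (n δ μ²)) { (q* ∧ rank(X) + m) r* + (p − q*) log q* }. -/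
open MeasureTheory Matrix

noncomputable section

/-- The space of real `k × l` matrices. -/
abbrev Mat (k l : ℕ) := Matrix (Fin k) (Fin l) ℝ

/-- Frobenius (trace) inner product. -/
def mip {k l : ℕ} (A B : Mat k l) : ℝ := ∑ i, ∑ j, A i j * B i j

/-- Squared Frobenius norm. -/
def frobSq {k l : ℕ} (A : Mat k l) : ℝ := mip A A

/-- Number of distinct rows of a matrix, `‖B‖_{2,C}`. -/
def distinctRows {k l : ℕ} (A : Mat k l) : ℕ := (Set.range fun i => A i).ncard

/-- Squared `(2,∞)` norm: `‖B‖_{2,∞}² = max_j ‖b_j‖₂²`. -/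
def row2InfSq {k l : ℕ} (A : Mat k l) : ℝ := ⨆ j : Fin k, ∑ i, (A j i) ^ 2

/-- `g` is the (Frobenius) gradient of the differentiable function `f`. -/
def IsGradientOf {k l : ℕ} (f : Mat k l → ℝ) (g : Mat k l → Mat k l) : Prop :=
  ∀ Θ H, HasDerivAt (fun t : ℝ => f (Θ + t • H)) (mip (g Θ) H) 0

/-- `f` (with gradient `g`) is `μ`-strongly convex. -/
def StronglyConvexWith {k l : ℕ} (f : Mat k l → ℝ) (g : Mat k l → Mat k l) (μs : ℝ) : Prop :=
  ∀ η η' : Mat k l, f η + mip (g η) (η' - η) + μs * frobSq (η' - η) / 2 ≤ f η'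

/-- `vec(E)` is a zero-mean sub-Gaussian random vector with scale bounded by `σ`. -/
def SubG {Ω : Type*} [MeasurableSpace Ω] (μ : Measure Ω) {k l : ℕ}
    (E : Ω → Mat k l) (σ : ℝ) : Prop :=
  (∀ A : Mat k l, Integrable (fun ω => mip (E ω) A) μ ∧ ∫ ω, mip (E ω) A ∂μ = 0) ∧
  (∀ A : Mat k l, ∀ t : ℝ, σ * Real.sqrt (frobSq A) < t →
    ∫⁻ ω, ENNReal.ofReal (Real.exp ((mip (E ω) A / t) ^ 2)) ∂μ ≤ 2)

lemma aux_net (F : Type*) [NormedAddCommGroup F] [NormedSpace ℝ F] [FiniteDimensional ℝ F] :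
    ∃ N : Finset F, N.card ≤ 5 ^ Module.finrank ℝ F ∧ (∀ x ∈ N, ‖x‖ ≤ 1) ∧
      ∀ x : F, ‖x‖ ≤ 1 → ∃ y ∈ N, ‖x - y‖ ≤ 1 / 2 := by
  classical
  by_contra hcon
  push Not at hcon
  have key : ∀ k : ℕ, ∃ N : Finset F, N.card = k ∧ (∀ x ∈ N, ‖x‖ ≤ 1) ∧
      ∀ x ∈ N, ∀ y ∈ N, x ≠ y → 1 / 2 ≤ ‖x - y‖ := by
    intro k
    induction k with
    | zero => exact ⟨∅, by simp⟩
    | succ k ih =>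
      obtain ⟨N, hc, hb, hs⟩ := ih
      have hcard : N.card ≤ 5 ^ Module.finrank ℝ F := by
        have hinj : Function.Injective (fun x : F => (2 : ℝ) • x) :=
          smul_right_injective F (two_ne_zero)
        have := Besicovitch.card_le_of_separated (N.image (fun x : F => (2 : ℝ) • x)) ?_ ?_
        · rwa [Finset.card_image_of_injective _ hinj] at this
        · intro c hc'
          obtain ⟨x, hx, rfl⟩ := Finset.mem_image.1 hc'
          rw [norm_smul]; have := hb x hx; norm_num; linarith
        · intro c hc' d hd' hcd
          obtain ⟨x, hx, rfl⟩ := Finset.mem_image.1 hc'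
          obtain ⟨y, hy, rfl⟩ := Finset.mem_image.1 hd'
          have hxy : x ≠ y := fun h => hcd (by rw [h])
          have := hs x hx y hy hxy
          rw [← smul_sub, norm_smul]; norm_num; linarith
      obtain ⟨x, hx, hxN⟩ := hcon N hcard hb
      have hxn : x ∉ N := fun h => by
        have := hxN x h
        simp at this
        linarith
      refine ⟨insert x N, by rw [Finset.card_insert_of_notMem hxn, hc], ?_, ?_⟩
      · intro y hy
        rcases Finset.mem_insert.1 hy with rfl | hy
        · exact hx
        · exact hb y hy
      · intro y hy z hz hyz
        rcases Finset.mem_insert.1 hy with h1 | h1 <;> rcases Finset.mem_insert.1 hz with h2 | h2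
        · exact absurd (h1.trans h2.symm) hyz
        · rw [h1]; exact (hxN z h2).le
        · rw [h2, norm_sub_rev]; exact (hxN y h1).le
        · exact hs y h1 z h2 hyz
  obtain ⟨N, hc, hb, hs⟩ := key (5 ^ Module.finrank ℝ F + 1)
  have hinj : Function.Injective (fun x : F => (2 : ℝ) • x) :=
    smul_right_injective F (two_ne_zero)
  have := Besicovitch.card_le_of_separated (N.image (fun x : F => (2 : ℝ) • x)) ?_ ?_
  · rw [Finset.card_image_of_injective _ hinj] at this
    omega
  · intro c hc'
    obtain ⟨x, hx, rfl⟩ := Finset.mem_image.1 hc'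
    rw [norm_smul]; have := hb x hx; norm_num; linarith
  · intro c hc' d hd' hcd
    obtain ⟨x, hx, rfl⟩ := Finset.mem_image.1 hc'
    obtain ⟨y, hy, rfl⟩ := Finset.mem_image.1 hd'
    have hxy : x ≠ y := fun h => hcd (by rw [h])
    have := hs x hx y hy hxy
    rw [← smul_sub, norm_smul]; norm_num; linarith

lemma aux_lin {F : Type*} [NormedAddCommGroup F] [NormedSpace ℝ F] [FiniteDimensional ℝ F]
    (N : Finset F) (hN : ∀ x : F, ‖x‖ ≤ 1 → ∃ y ∈ N, ‖x - y‖ ≤ 1 / 2)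
    (φ : F →ₗ[ℝ] ℝ) (s : ℝ) (hs : ∀ y ∈ N, φ y ≤ s) (x : F) : φ x ≤ 2 * s * ‖x‖ := by
  set f : F →L[ℝ] ℝ := LinearMap.toContinuousLinearMap φ with hf
  have hfx : ∀ x, f x = φ x := fun x => rfl
  have h1 : ∀ x : F, ‖x‖ ≤ 1 → f x ≤ s + ‖f‖ * (1 / 2) := by
    intro x hx
    obtain ⟨y, hy, hxy⟩ := hN x hx
    have e : f x = f y + f (x - y) := by rw [← map_add]; congr 1; abel
    have h2 : f (x - y) ≤ ‖f‖ * (1 / 2) :=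
      (le_abs_self _).trans ((f.le_opNorm _).trans (by gcongr))
    have h3 := hs y hy
    rw [← hfx] at h3
    linarith
  have h0 := h1 0 (by simp)
  rw [map_zero] at h0
  have hn : ‖f‖ ≤ s + ‖f‖ * (1 / 2) := by
    refine ContinuousLinearMap.opNorm_le_of_unit_norm h0 ?_
    intro x hx
    rw [Real.norm_eq_abs, abs_le]
    have := h1 (-x) (by rw [norm_neg, hx])
    rw [map_neg] at this
    exact ⟨by linarith, h1 x hx.le⟩
  calc φ x = f x := rfl
    _ ≤ ‖f‖ * ‖x‖ := (le_abs_self _).trans (f.le_opNorm _)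
    _ ≤ 2 * s * ‖x‖ := by gcongr; linarith

lemma aux_bilin {F G : Type*} [NormedAddCommGroup F] [NormedSpace ℝ F] [FiniteDimensional ℝ F]
    [NormedAddCommGroup G] [NormedSpace ℝ G] [FiniteDimensional ℝ G]
    (N : Finset F) (hN : ∀ x : F, ‖x‖ ≤ 1 → ∃ y ∈ N, ‖x - y‖ ≤ 1 / 2)
    (M : Finset G) (hM : ∀ x : G, ‖x‖ ≤ 1 → ∃ y ∈ M, ‖x - y‖ ≤ 1 / 2)
    (b : F →ₗ[ℝ] G →ₗ[ℝ] ℝ) (s : ℝ) (hs : ∀ y ∈ N, ∀ z ∈ M, b y z ≤ s) (x : F) (w : G) :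
    b x w ≤ 4 * s * ‖x‖ * ‖w‖ := by
  have h1 : ∀ y ∈ N, b y w ≤ 2 * s * ‖w‖ := fun y hy => aux_lin M hM (b y) s (hs y hy) w
  have h2 := aux_lin N hN (b.flip w) (2 * s * ‖w‖) (by simpa using h1) x
  simp only [LinearMap.flip_apply] at h2
  linarith

lemma aux_isom {U : Type*} [NormedAddCommGroup U] [InnerProductSpace ℝ U] [FiniteDimensional ℝ U]
    (R : ℕ) (h : Module.finrank ℝ U ≤ R) : Nonempty (U →ₗᵢ[ℝ] EuclideanSpace ℝ (Fin R)) := by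
  let b := stdOrthonormalBasis ℝ U
  let v : Fin (Module.finrank ℝ U) → EuclideanSpace ℝ (Fin R) :=
    fun i => EuclideanSpace.basisFun (Fin R) ℝ (Fin.castLE h i)
  have hv : Orthonormal ℝ v :=
    (EuclideanSpace.basisFun (Fin R) ℝ).orthonormal.comp _ (Fin.castLE_injective h)
  refine ⟨(b.toBasis.constr ℝ v).isometryOfOrthonormal (v := b.toBasis) ?_ ?_⟩
  · simp
  · convert hv using 1
    ext1 i
    simp only [Function.comp, Module.Basis.constr_basis]

/-- column of a matrix as a Euclidean vector -/
def ecol {n m : ℕ} (A : Mat n m) (j : Fin m) : EuclideanSpace ℝ (Fin n) :=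
  WithLp.toLp 2 (fun i => A i j)

lemma frobSq_eq_ecol {n m : ℕ} (A : Mat n m) : frobSq A = ∑ j, ‖ecol A j‖ ^ 2 := by
  simp only [EuclideanSpace.real_norm_sq_eq, frobSq, mip, ecol]
  rw [Finset.sum_comm]
  simp only [sq]

lemma frobSq_nonneg {n m : ℕ} (A : Mat n m) : 0 ≤ frobSq A := by
  rw [frobSq_eq_ecol]; positivity

lemma finrank_span_ecol {n m : ℕ} (A : Mat n m) :
    Module.finrank ℝ (Submodule.span ℝ (Set.range (ecol A))) = A.rank := by
  rw [Matrix.rank_eq_finrank_span_cols]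
  have : Set.range (ecol A) =
      ((WithLp.linearEquiv 2 ℝ (Fin n → ℝ)).symm : (Fin n → ℝ) →ₗ[ℝ] EuclideanSpace ℝ (Fin n)) ''
        (Set.range A.col) := by
    rw [← Set.range_comp]; rfl
  rw [this, Submodule.span_image]
  exact LinearEquiv.finrank_map_eq _ _

/-- product of an operator with a family of columns -/
def phi {n m R : ℕ} (W : Submodule ℝ (EuclideanSpace ℝ (Fin n)))
    (H : EuclideanSpace ℝ (Fin R) →L[ℝ] W)
    (K : PiLp 2 (fun _ : Fin m => EuclideanSpace ℝ (Fin R))) : Mat n m :=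
  fun i j => (H (K j) : EuclideanSpace ℝ (Fin n)) i

lemma phi_frob {n m R : ℕ} (W : Submodule ℝ (EuclideanSpace ℝ (Fin n)))
    (H : EuclideanSpace ℝ (Fin R) →L[ℝ] W)
    (K : PiLp 2 (fun _ : Fin m => EuclideanSpace ℝ (Fin R))) (hH : ‖H‖ ≤ 1) (hK : ‖K‖ ≤ 1) :
    frobSq (phi W H K) ≤ 1 := by
  have h1 : ∀ j, ecol (phi W H K) j = (H (K j) : EuclideanSpace ℝ (Fin n)) := fun j => rfl
  rw [frobSq_eq_ecol]
  calc ∑ j, ‖ecol (phi W H K) j‖ ^ 2 ≤ ∑ j, ‖K j‖ ^ 2 := by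
        gcongr with j
        rw [h1, Submodule.norm_coe]
        calc ‖H (K j)‖ ≤ ‖H‖ * ‖K j‖ := H.le_opNorm _
          _ ≤ 1 * ‖K j‖ := by gcongr
          _ = _ := one_mul _
    _ = ‖K‖ ^ 2 := (PiLp.norm_sq_eq_of_L2 _ K).symm
    _ ≤ 1 := by nlinarith [norm_nonneg K]

lemma mip_add_right {k l : ℕ} (E A B : Mat k l) : mip E (A + B) = mip E A + mip E B := by
  simp [mip, mul_add, Finset.sum_add_distrib]

lemma mip_smul_right {k l : ℕ} (E A : Mat k l) (c : ℝ) : mip E (c • A) = c * mip E A := by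
  simp only [mip, Finset.mul_sum, Matrix.smul_apply, smul_eq_mul]
  refine Finset.sum_congr rfl fun i _ => Finset.sum_congr rfl fun j _ => by ring

/-- the bilinear form -/
def bform {n m R : ℕ} (E : Mat n m) (W : Submodule ℝ (EuclideanSpace ℝ (Fin n))) :
    (EuclideanSpace ℝ (Fin R) →L[ℝ] W) →ₗ[ℝ]
      (PiLp 2 (fun _ : Fin m => EuclideanSpace ℝ (Fin R))) →ₗ[ℝ] ℝ :=
  LinearMap.mk₂ ℝ (fun H K => mip E (phi W H K))
    (fun H H' K => by
      rw [← mip_add_right]; congr 1)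
    (fun c H K => by
      rw [smul_eq_mul, ← mip_smul_right]; congr 1)
    (fun H K K' => by
      rw [← mip_add_right]; congr 1; ext i j; simp [phi])
    (fun c H K => by
      rw [smul_eq_mul, ← mip_smul_right]; congr 1; ext i j; simp [phi])

lemma aux_lowrank {n m : ℕ} (W : Submodule ℝ (EuclideanSpace ℝ (Fin n))) (R : ℕ) :
    ∃ N : Finset (Mat n m), N.card ≤ 5 ^ (R * (Module.finrank ℝ W + m)) ∧
      (∀ A ∈ N, frobSq A ≤ 1) ∧
      ∀ (E : Mat n m) (s : ℝ), (∀ A ∈ N, mip E A ≤ s) →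
        ∀ A : Mat n m, (∀ j, ecol A j ∈ W) → A.rank ≤ R →
          mip E A ≤ 4 * s * Real.sqrt (frobSq A) := by
  classical
  obtain ⟨N1, hc1, hb1, hn1⟩ := aux_net (EuclideanSpace ℝ (Fin R) →L[ℝ] W)
  obtain ⟨N2, hc2, hb2, hn2⟩ := aux_net (PiLp 2 (fun _ : Fin m => EuclideanSpace ℝ (Fin R)))
  have d1 : Module.finrank ℝ (EuclideanSpace ℝ (Fin R) →L[ℝ] W) = R * Module.finrank ℝ W := by
    rw [← (LinearMap.toContinuousLinearMap (𝕜 := ℝ) (E := EuclideanSpace ℝ (Fin R))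
      (F' := W)).finrank_eq, Module.finrank_linearMap, finrank_euclideanSpace, Fintype.card_fin]
  have d2 : Module.finrank ℝ (PiLp 2 (fun _ : Fin m => EuclideanSpace ℝ (Fin R))) = R * m := by
    rw [(WithLp.linearEquiv 2 ℝ (Fin m → EuclideanSpace ℝ (Fin R))).finrank_eq,
      Module.finrank_pi_fintype]
    simp [mul_comm]
  refine ⟨(N1 ×ˢ N2).image (fun q => phi W q.1 q.2), ?_, ?_, ?_⟩
  · refine Finset.card_image_le.trans ?_
    rw [Finset.card_product, mul_add, pow_add]
    rw [d1] at hc1; rw [d2] at hc2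
    exact Nat.mul_le_mul hc1 hc2
  · intro A hA
    obtain ⟨q, hq, rfl⟩ := Finset.mem_image.1 hA
    rw [Finset.mem_product] at hq
    exact phi_frob W q.1 q.2 (hb1 _ hq.1) (hb2 _ hq.2)
  · intro E s hs A hAW hAR
    have hs' : ∀ y ∈ N1, ∀ z ∈ N2, bform E W y z ≤ s := by
      intro y hy z hz
      exact hs _ (Finset.mem_image.2 ⟨(y, z), Finset.mem_product.2 ⟨hy, hz⟩, rfl⟩)
    have key := aux_bilin N1 hn1 N2 hn2 (bform E W) s hs'
    set U := Submodule.span ℝ (Set.range (ecol A)) with hU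
    have hUW : U ≤ W := Submodule.span_le.2 (by rintro _ ⟨j, rfl⟩; exact hAW j)
    have hUR : Module.finrank ℝ U ≤ R := by rw [hU, finrank_span_ecol]; exact hAR
    obtain ⟨J⟩ := aux_isom R hUR
    let u : Fin m → U := fun j => ⟨ecol A j, Submodule.subset_span ⟨j, rfl⟩⟩
    let inc : U →ₗᵢ[ℝ] W := ⟨Submodule.inclusion hUW, fun x => rfl⟩
    let H : EuclideanSpace ℝ (Fin R) →L[ℝ] W :=
      inc.toContinuousLinearMap.comp (ContinuousLinearMap.adjoint J.toContinuousLinearMap)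
    let K : PiLp 2 (fun _ : Fin m => EuclideanSpace ℝ (Fin R)) := WithLp.toLp 2 (fun j => J (u j))
    have hH : ‖H‖ ≤ 1 := by
      refine (ContinuousLinearMap.opNorm_comp_le _ _).trans ?_
      rw [LinearIsometryEquiv.norm_map]
      have a1 := LinearIsometry.norm_toContinuousLinearMap_le inc
      have a2 := LinearIsometry.norm_toContinuousLinearMap_le J
      have a3 : 0 ≤ ‖J.toContinuousLinearMap‖ := norm_nonneg J.toContinuousLinearMap
      nlinarith
    have hadj : ∀ x : U, ContinuousLinearMap.adjoint J.toContinuousLinearMap (J x) = x := by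
      intro x
      refine ext_inner_left ℝ fun y => ?_
      rw [ContinuousLinearMap.adjoint_inner_right]
      exact J.inner_map_map y x
    have hphi : phi W H K = A := by
      ext i j
      have : H (K j) = inc (u j) := by
        change inc (ContinuousLinearMap.adjoint J.toContinuousLinearMap (J (u j))) = _
        rw [hadj]
      simp only [phi, this]
      rfl
    have hK : ‖K‖ = Real.sqrt (frobSq A) := by
      rw [PiLp.norm_eq_of_L2, frobSq_eq_ecol]
      congr 1
      refine Finset.sum_congr rfl fun j _ => ?_
      change ‖J (u j)‖ ^ 2 = _
      rw [J.norm_map]; rfl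
    have h1 := key H K
    have h2 := key 0 K
    have e : bform E W H K = mip E A := by change mip E (phi W H K) = _; rw [hphi]
    rw [e, hK] at h1
    have hs0 : 0 ≤ s := by
      obtain ⟨y, hy, -⟩ := hn1 0 (by rw [ContinuousLinearMap.opNorm_zero]; exact zero_le_one)
      obtain ⟨z, hz, -⟩ := hn2 0 (by rw [norm_zero]; exact zero_le_one)
      by_contra hneg
      push Not at hneg
      have h3 := aux_lin N2 hn2 (bform E W y) s (hs' y hy) 0
      have h4 : ∀ z, bform E W y z ≤ 2 * s * ‖z‖ := aux_lin N2 hn2 (bform E W y) s (hs' y hy)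
      have h5 := h4 z
      have h6 := h4 (-z)
      rw [map_neg, norm_neg] at h6
      have h7 : ‖z‖ = 0 := by nlinarith [norm_nonneg z]
      have h8 := hs' y hy z hz
      rw [norm_eq_zero.1 h7, map_zero] at h8
      linarith
    refine h1.trans ?_
    have : 4 * s * ‖H‖ ≤ 4 * s := by nlinarith
    exact mul_le_mul_of_nonneg_right this (Real.sqrt_nonneg _)
lemma aux_choose (Q k : ℕ) : (Q + k).choose k ≤ (Q + 1) ^ k := by
  induction k with
  | zero => simp
  | succ k ih =>
    have h := Nat.add_one_mul_choose_eq (Q + k) k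
    have h2 : (Q + k + 1).choose (k + 1) * (k + 1) ≤ (Q + 1) ^ (k + 1) * (k + 1) := by
      rw [← h, pow_succ]
      calc (Q + k + 1) * (Q + k).choose k ≤ ((Q + 1) * (k + 1)) * (Q + 1) ^ k := by
            apply Nat.mul_le_mul _ ih
            nlinarith
        _ = _ := by ring
    exact Nat.le_of_mul_le_mul_right h2 (Nat.succ_pos k)

lemma aux_family (p Q : ℕ) (hQ : Q ≤ p) :
    ∃ G : Finset (Fin p → Fin p), G.card ≤ (Q + 1) ^ (2 * (p - Q)) ∧
      (∀ h ∈ G, (Finset.univ.image h).card ≤ Q) ∧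
      ∀ (m : ℕ) (B : Mat p m), distinctRows B ≤ Q → ∃ h ∈ G, ∀ i, B i = B (h i) := by
  classical
  refine ⟨(Finset.powersetCard Q Finset.univ).biUnion
    (fun S => Fintype.piFinset (fun i => if i ∈ S then {i} else S)), ?_, ?_, ?_⟩
  · refine Finset.card_biUnion_le.trans ?_
    have h1 : ∀ S ∈ Finset.powersetCard Q (Finset.univ : Finset (Fin p)),
        (Fintype.piFinset (fun i => if i ∈ S then {i} else S)).card ≤ (Q + 1) ^ (p - Q) := by
      intro S hS
      have hc := (Finset.mem_powersetCard.1 hS).2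
      rw [Fintype.card_piFinset]
      have : ∀ i : Fin p, (if i ∈ S then {i} else S : Finset (Fin p)).card =
          if i ∈ S then 1 else Q := by
        intro i; split_ifs <;> simp [hc]
      simp only [this]
      rw [Finset.prod_ite, Finset.prod_const_one, one_mul, Finset.prod_const]
      have h3 : (Finset.univ.filter (fun i => i ∉ S)).card = p - Q := by
        rw [Finset.filter_not, Finset.card_sdiff]
        simp [hc]
      rw [h3]
      exact Nat.pow_le_pow_left (Nat.le_succ Q) _
    refine (Finset.sum_le_card_nsmul _ _ _ h1).trans ?_
    rw [Finset.card_powersetCard, Finset.card_univ, Fintype.card_fin, smul_eq_mul, two_mul, pow_add]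
    refine Nat.mul_le_mul_right _ ?_
    have := aux_choose Q (p - Q)
    rwa [Nat.add_sub_cancel' hQ, Nat.choose_symm hQ] at this
  · intro h hh
    obtain ⟨S, hS, hm⟩ := Finset.mem_biUnion.1 hh
    have hc := (Finset.mem_powersetCard.1 hS).2
    rw [← hc]
    refine Finset.card_le_card ?_
    intro x hx
    obtain ⟨i, -, rfl⟩ := Finset.mem_image.1 hx
    have := Fintype.mem_piFinset.1 hm i
    split_ifs at this with hi
    · rw [Finset.mem_singleton.1 this]; exact hi
    · exact this
  · intro m B hB
    have hex : ∀ v : Set.range (fun i => B i), ∃ i, B i = v := fun v => v.2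
    choose pick hpick using hex
    let S0 : Finset (Fin p) := Finset.univ.image (fun v : Set.range (fun i => B i) => pick v)
    have hS0 : S0.card ≤ Q := by
      refine Finset.card_image_le.trans ?_
      rw [Finset.card_univ, ← Nat.card_eq_fintype_card]
      exact hB
    obtain ⟨S, hS1, -, hS2⟩ := Finset.exists_subsuperset_card_eq (Finset.subset_univ S0) hS0
      (by simpa using hQ)
    refine ⟨fun i => if i ∈ S then i else pick ⟨B i, i, rfl⟩, ?_, ?_⟩
    · refine Finset.mem_biUnion.2 ⟨S, Finset.mem_powersetCard.2 ⟨Finset.subset_univ _, hS2⟩, ?_⟩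
      refine Fintype.mem_piFinset.2 fun i => ?_
      by_cases hi : i ∈ S
      · simp [hi]
      · simp only [hi, if_false]
        exact hS1 (Finset.mem_image.2 ⟨_, Finset.mem_univ _, rfl⟩)
    · intro i
      by_cases hi : i ∈ S
      · simp [hi]
      · simp only [hi, if_false]
        exact (hpick ⟨B i, i, rfl⟩).symm

lemma finrank_funLeft {p Q : ℕ} (h : Fin p → Fin p) (hh : (Finset.univ.image h).card ≤ Q) :
    Module.finrank ℝ (LinearMap.range (LinearMap.funLeft ℝ ℝ h)) ≤ Q := by
  classical
  let S := Finset.univ.image h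
  let h' : Fin p → S := fun i => ⟨h i, Finset.mem_image.2 ⟨i, Finset.mem_univ _, rfl⟩⟩
  have hle : LinearMap.range (LinearMap.funLeft ℝ ℝ h) ≤
      LinearMap.range (LinearMap.funLeft ℝ ℝ h') := by
    rintro _ ⟨v, rfl⟩
    exact ⟨fun x => v x.1, rfl⟩
  refine (Submodule.finrank_mono hle).trans ((LinearMap.finrank_range_le _).trans ?_)
  rw [Module.finrank_fintype_fun_eq_card, Fintype.card_coe]
  exact hh

/-- `X` as a linear map to Euclidean space -/
def xlin {n p : ℕ} (X : Mat n p) : (Fin p → ℝ) →ₗ[ℝ] EuclideanSpace ℝ (Fin n) :=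
  ((WithLp.linearEquiv 2 ℝ (Fin n → ℝ)).symm : (Fin n → ℝ) →ₗ[ℝ] EuclideanSpace ℝ (Fin n)) ∘ₗ
    X.mulVecLin

/-- the subspace attached to two labellings -/
def wsp {n p : ℕ} (X : Mat n p) (h h' : Fin p → Fin p) :
    Submodule ℝ (EuclideanSpace ℝ (Fin n)) :=
  (LinearMap.range (LinearMap.funLeft ℝ ℝ h) ⊔ LinearMap.range (LinearMap.funLeft ℝ ℝ h')).map
    (xlin X)

lemma finrank_wsp_le {n p : ℕ} (X : Mat n p) (h h' : Fin p → Fin p) (Q Q' : ℕ)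
    (hh : (Finset.univ.image h).card ≤ Q) (hh' : (Finset.univ.image h').card ≤ Q') :
    Module.finrank ℝ (wsp X h h') ≤ Q + Q' := by
  refine (Submodule.finrank_map_le _ _).trans ?_
  refine (Submodule.finrank_add_le_finrank_add_finrank _ _).trans ?_
  exact Nat.add_le_add (finrank_funLeft h hh) (finrank_funLeft h' hh')

lemma finrank_wsp_le_rank {n p : ℕ} (X : Mat n p) (h h' : Fin p → Fin p) :
    Module.finrank ℝ (wsp X h h') ≤ X.rank := by
  have h1 : wsp X h h' ≤ LinearMap.range (xlin X) := LinearMap.map_le_range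
  refine (Submodule.finrank_mono h1).trans ?_
  rw [xlin, LinearMap.range_comp]
  exact (Submodule.finrank_map_le _ _)

lemma ecol_mem_wsp {n p m : ℕ} (X : Mat n p) (h h' : Fin p → Fin p) (B B' : Mat p m)
    (hB : ∀ i, B i = B (h i)) (hB' : ∀ i, B' i = B' (h' i)) (j : Fin m) :
    ecol (X * (B - B')) j ∈ wsp X h h' := by
  refine ⟨fun i => (B - B') i j, ?_, ?_⟩
  · have : (fun i => (B - B') i j) = (fun i => B i j) - (fun i => B' i j) := rfl
    rw [this]
    refine Submodule.sub_mem _ (Submodule.mem_sup_left ⟨fun i => B i j, ?_⟩)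
      (Submodule.mem_sup_right ⟨fun i => B' i j, ?_⟩)
    · ext i; exact (congrFun (hB i) j).symm
    · ext i; exact (congrFun (hB' i) j).symm
  · rfl

lemma rank_sub_le' {p m : ℕ} (A B : Mat p m) : (A - B).rank ≤ A.rank + B.rank := by
  unfold Matrix.rank
  refine le_trans ?_ (Submodule.finrank_add_le_finrank_add_finrank _ _)
  refine Submodule.finrank_mono ?_
  rintro _ ⟨v, rfl⟩
  rw [Matrix.mulVecLin_apply, Matrix.sub_mulVec]
  exact Submodule.sub_mem _ (Submodule.mem_sup_left ⟨v, rfl⟩) (Submodule.mem_sup_right ⟨v, rfl⟩)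

lemma distinctRows_sub_le {p m : ℕ} (A B : Mat p m) :
    distinctRows (A - B) ≤ distinctRows A * distinctRows B := by
  unfold distinctRows
  rw [← Set.ncard_prod]
  have : (Set.range fun i => (A - B) i) ⊆ (fun q : (Fin m → ℝ) × (Fin m → ℝ) => q.1 - q.2) ''
      ((Set.range fun i => A i) ×ˢ (Set.range fun i => B i)) := by
    rintro _ ⟨i, rfl⟩
    exact ⟨(A i, B i), ⟨⟨i, rfl⟩, ⟨i, rfl⟩⟩, rfl⟩
  have hf : ((Set.range fun i => A i) ×ˢ (Set.range fun i => B i)).Finite :=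
    (Set.finite_range _).prod (Set.finite_range _)
  exact (Set.ncard_le_ncard this (hf.image _)).trans (Set.ncard_image_le hf)

lemma distinctRows_le {p m : ℕ} (A : Mat p m) : distinctRows A ≤ p := by
  unfold distinctRows
  rw [← Set.image_univ]
  refine (Set.ncard_image_le Set.finite_univ).trans ?_
  simp [Set.ncard_univ]

lemma aux_tail {Ω : Type*} [MeasurableSpace Ω] (μ : Measure Ω) [IsProbabilityMeasure μ] {k l : ℕ}
    (E : Ω → Mat k l) (σ : ℝ) (hE : SubG μ E σ) (A : Mat k l) (hA : frobSq A ≤ 1)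
    (M : ℝ) (hM : 0 < M) :
    μ {ω | 2 * |σ| * Real.sqrt M < mip (E ω) A} ≤ ENNReal.ofReal (2 * Real.exp (-M)) := by
  have hsq : Real.sqrt (frobSq A) ≤ 1 := Real.sqrt_le_one.2 hA
  have hmeas : AEMeasurable (fun ω => mip (E ω) A) μ := (hE.1 A).1.aemeasurable
  -- basic tail
  have tail : ∀ t : ℝ, |σ| < t → μ {ω | t * Real.sqrt M ≤ mip (E ω) A} ≤
      ENNReal.ofReal (2 * Real.exp (-M)) := by
    intro t ht
    have ht0 : 0 < t := (abs_nonneg σ).trans_lt ht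
    have h1 : σ * Real.sqrt (frobSq A) < t := by
      refine lt_of_le_of_lt ?_ ht
      have := le_abs_self σ
      nlinarith [abs_nonneg σ, Real.sqrt_nonneg (frobSq A)]
    have h2 := hE.2 A t h1
    have hm : AEMeasurable (fun ω => ENNReal.ofReal (Real.exp ((mip (E ω) A / t) ^ 2))) μ := by
      fun_prop
    have h3 := meas_ge_le_lintegral_div hm (ε := ENNReal.ofReal (Real.exp M))
      (by simpa using Real.exp_pos M) ENNReal.ofReal_ne_top
    calc μ {ω | t * Real.sqrt M ≤ mip (E ω) A}
        ≤ μ {ω | ENNReal.ofReal (Real.exp M) ≤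
            ENNReal.ofReal (Real.exp ((mip (E ω) A / t) ^ 2))} := by
          refine measure_mono fun ω hω => ?_
          simp only [Set.mem_ofPred_eq] at hω ⊢
          refine ENNReal.ofReal_le_ofReal (Real.exp_le_exp.2 ?_)
          have h4 : Real.sqrt M ≤ mip (E ω) A / t := by
            rw [le_div_iff₀ ht0]; linarith
          calc M = Real.sqrt M ^ 2 := (Real.sq_sqrt hM.le).symm
            _ ≤ _ := by gcongr
      _ ≤ _ := h3
      _ ≤ 2 / ENNReal.ofReal (Real.exp M) := by gcongr
      _ = ENNReal.ofReal (2 * Real.exp (-M)) := by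
          rw [Real.exp_neg, ← div_eq_mul_inv, ENNReal.ofReal_div_of_pos (Real.exp_pos M)]
          simp
  by_cases hσ : σ = 0
  · subst hσ
    have hsub : {ω | 2 * |(0 : ℝ)| * Real.sqrt M < mip (E ω) A} =
        ⋃ i : ℕ, {ω | (1 / ((i : ℝ) + 1)) * Real.sqrt M ≤ mip (E ω) A} := by
      ext ω
      simp only [abs_zero, mul_zero, zero_mul, Set.mem_ofPred_eq, Set.mem_iUnion]
      have hsM := Real.sqrt_pos.2 hM
      constructor
      · intro h
        obtain ⟨i, hi⟩ := exists_nat_one_div_lt (div_pos h hsM)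
        refine ⟨i, ?_⟩
        rw [lt_div_iff₀ hsM] at hi
        exact hi.le
      · rintro ⟨i, hi⟩
        refine lt_of_lt_of_le ?_ hi
        positivity
    rw [hsub, Monotone.measure_iUnion]
    · refine iSup_le fun i => tail _ ?_
      rw [abs_zero]; positivity
    · intro i j hij ω hω
      simp only [Set.mem_ofPred_eq] at hω ⊢
      refine le_trans ?_ hω
      gcongr
  · refine le_trans (measure_mono fun ω hω => ?_) (tail (2 * |σ|) ?_)
    · simp only [Set.mem_ofPred_eq] at hω ⊢
      exact hω.le
    · have := abs_pos.2 hσ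
      linarith
lemma aux_numeric (q r rX p m Q R D Gc : ℕ) (ϑ L : ℝ) (hq : 2 ≤ q) (hqp : q ≤ p)
    (hϑ : 1 ≤ ϑ) (hqQ : q ≤ Q) (hQp : Q ≤ p) (hQ : (Q : ℝ) ≤ ϑ * q)
    (hR : (R : ℝ) ≤ (1 + ϑ) * r) (hD1 : D ≤ Q + q) (hD2 : D ≤ rX)
    (hG : Gc ≤ (Q + 1) ^ (2 * (p - Q)))
    (hL : L = ((min q rX + m : ℕ) : ℝ) * r + ((p : ℝ) - q) * Real.log q) :
    (Gc : ℝ) * 5 ^ (R * (D + m)) ≤ Real.exp (12 * ϑ ^ 2 * L) := by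
  have hq' : (2 : ℝ) ≤ q := by exact_mod_cast hq
  have hqp' : (q : ℝ) ≤ p := by exact_mod_cast hqp
  have hlog2 : (1 / 2 : ℝ) ≤ Real.log 2 := by have := Real.log_two_gt_d9; linarith
  have hlogq : Real.log 2 ≤ Real.log q := Real.log_le_log (by norm_num) hq'
  have hlq : (1 / 2 : ℝ) ≤ Real.log q := hlog2.trans hlogq
  have h5 : (5 : ℝ) ≤ Real.exp 2 := by
    have h1 := Real.exp_one_gt_d9
    have : Real.exp 2 = Real.exp 1 * Real.exp 1 := by rw [← Real.exp_add]; norm_num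
    nlinarith
  have hlogQ : Real.log (Q + 1) ≤ 2 * ϑ * Real.log q := by
    have h1 : (Q : ℝ) + 1 ≤ 2 * ϑ * q := by nlinarith
    have h2 : Real.log (Q + 1) ≤ Real.log (2 * ϑ * q) := Real.log_le_log (by positivity) h1
    rw [Real.log_mul (by positivity) (by positivity), Real.log_mul (by norm_num) (by positivity)]
      at h2
    have h3 : Real.log ϑ ≤ ϑ - 1 := Real.log_le_sub_one_of_pos (by linarith)
    nlinarith
  have hG' : (Gc : ℝ) ≤ Real.exp (4 * ϑ ^ 2 * (((p : ℝ) - q) * Real.log q)) := by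
    have h1 : (Gc : ℝ) ≤ ((Q : ℝ) + 1) ^ (2 * (p - Q)) := by exact_mod_cast hG
    refine h1.trans ?_
    have h2 : ((Q : ℝ) + 1) ^ (2 * (p - Q)) =
        Real.exp (((2 * (p - Q) : ℕ) : ℝ) * Real.log (Q + 1)) := by
      rw [Real.exp_nat_mul, Real.exp_log (by positivity)]
    rw [h2]
    refine Real.exp_le_exp.2 ?_
    push_cast [Nat.cast_sub hQp]
    have hQ' : (q : ℝ) ≤ Q := by exact_mod_cast hqQ
    have hQp' : (Q : ℝ) ≤ p := by exact_mod_cast hQp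
    calc 2 * ((p : ℝ) - Q) * Real.log (Q + 1) ≤ 2 * ((p : ℝ) - q) * (2 * ϑ * Real.log q) := by
          apply mul_le_mul _ hlogQ (Real.log_nonneg (by linarith)) (by linarith)
          linarith
      _ = 4 * ϑ * (((p : ℝ) - q) * Real.log q) := by ring
      _ ≤ 4 * ϑ ^ 2 * (((p : ℝ) - q) * Real.log q) := by
          apply mul_le_mul_of_nonneg_right
          · nlinarith
          · apply mul_nonneg <;> linarith
  have hN : (5 : ℝ) ^ (R * (D + m)) ≤
      Real.exp (8 * ϑ ^ 2 * (((min q rX + m : ℕ) : ℝ) * r)) := by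
    calc (5 : ℝ) ^ (R * (D + m)) ≤ (Real.exp 2) ^ (R * (D + m)) := by gcongr
      _ = Real.exp (((R * (D + m) : ℕ) : ℝ) * 2) := (Real.exp_nat_mul _ _).symm
      _ ≤ _ := by
        refine Real.exp_le_exp.2 ?_
        have hD : (D : ℝ) ≤ 2 * ϑ * ((min q rX : ℕ) : ℝ) := by
          have a1 : (D : ℝ) ≤ Q + q := by exact_mod_cast hD1
          have a2 : (D : ℝ) ≤ rX := by exact_mod_cast hD2
          rcases le_total q rX with h | h
          · rw [min_eq_left h]; nlinarith
          · rw [min_eq_right h]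
            have : (0 : ℝ) ≤ rX := by positivity
            nlinarith
        have hR' : (R : ℝ) ≤ 2 * ϑ * r := by
          have : (0 : ℝ) ≤ r := by positivity
          nlinarith
        have hDm : (D : ℝ) + m ≤ 2 * ϑ * (((min q rX + m : ℕ) : ℝ)) := by
          push_cast at hD ⊢
          have : (0 : ℝ) ≤ m := by positivity
          nlinarith
        rw [Nat.cast_mul, Nat.cast_add D m]
        calc (R : ℝ) * (D + m) * 2 ≤ (2 * ϑ * r) * (2 * ϑ * (((min q rX + m : ℕ) : ℝ))) * 2 := by
              gcongr
          _ = _ := by ring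
  calc (Gc : ℝ) * 5 ^ (R * (D + m)) ≤ Real.exp (4 * ϑ ^ 2 * (((p : ℝ) - q) * Real.log q)) *
        Real.exp (8 * ϑ ^ 2 * (((min q rX + m : ℕ) : ℝ) * r)) := by gcongr
    _ = Real.exp (4 * ϑ ^ 2 * (((p : ℝ) - q) * Real.log q) +
        8 * ϑ ^ 2 * (((min q rX + m : ℕ) : ℝ) * r)) := (Real.exp_add _ _).symm
    _ ≤ _ := by
      refine Real.exp_le_exp.2 ?_
      rw [hL]
      have a1 : 0 ≤ ϑ ^ 2 * (((p : ℝ) - q) * Real.log q) := by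
        apply mul_nonneg (by positivity)
        apply mul_nonneg <;> linarith
      have a2 : 0 ≤ ϑ ^ 2 * (((min q rX + m : ℕ) : ℝ) * r) := by positivity
      linarith

lemma aux_L (q r rX p m : ℕ) (L : ℝ) (hq : 2 ≤ q) (hqp : q ≤ p) (hr : 1 ≤ r) (hrX : rX ≤ p)
    (hL : L = ((min q rX + m : ℕ) : ℝ) * r + ((p : ℝ) - q) * Real.log q) :
    1 / 2 * ((m : ℝ) + rX) ≤ L := by
  have hq' : (2 : ℝ) ≤ q := by exact_mod_cast hq
  have hqp' : (q : ℝ) ≤ p := by exact_mod_cast hqp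
  have hrX' : (rX : ℝ) ≤ p := by exact_mod_cast hrX
  have hr' : (1 : ℝ) ≤ r := by exact_mod_cast hr
  have hlog2 : (1 / 2 : ℝ) ≤ Real.log 2 := by have := Real.log_two_gt_d9; linarith
  have hlogq : Real.log 2 ≤ Real.log q := Real.log_le_log (by norm_num) hq'
  have hlq : (1 / 2 : ℝ) ≤ Real.log q := hlog2.trans hlogq
  have h1 : ((min q rX + m : ℕ) : ℝ) ≤ ((min q rX + m : ℕ) : ℝ) * r := by
    have : (0 : ℝ) ≤ ((min q rX + m : ℕ) : ℝ) := by positivity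
    nlinarith
  have h2 : ((p : ℝ) - q) * (1 / 2) ≤ ((p : ℝ) - q) * Real.log q := by
    apply mul_le_mul_of_nonneg_left hlq; linarith
  have hm : (0 : ℝ) ≤ m := by positivity
  have hx : (0 : ℝ) ≤ rX := by positivity
  rcases le_total q rX with h | h
  · rw [min_eq_left h] at h1 hL
    push_cast at h1 hL; linarith
  · rw [min_eq_right h] at h1 hL
    push_cast at h1 hL; linarith

set_option maxHeartbeats 4000000 in
/-- **`(2,∞)`-norm estimation bound and cluster recovery for CRL.** Under `μ`-strong
convexity of the loss, sub-Gaussian(σ) effective noise, `q* = ‖B*‖_{2,C} > 1`, and the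
restricted eigenvalue condition `‖XB‖_F²/n ≥ δ ‖B‖_{2,∞}²` on
`{B : rank B ≤ (1+ϑ)r*, ‖B‖_{2,C} ≤ ϑ q*²}`, the global CRL minimizer over
`{B : ‖B‖_{2,C} ≤ ϑ q*, rank B ≤ ϑ r*}` satisfies, with probability at least
`1 - C exp{-c(m + rank X)}`,
`‖B̂ - B*‖_{2,∞}² ≤ (c₀ ϑ² σ²/(n δ μ²)){(q* ∧ rank X + m) r* + (p - q*) log q*}`. -/
theorem crl_two_inf_estimation_bound :
    ∃ c₀ c C : ℝ, 0 < c₀ ∧ 0 < c ∧ 0 < C ∧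
      ∀ (n m p : ℕ) (X : Mat n p) (Bstar : Mat p m)
        (Ω : Type) (_ : MeasurableSpace Ω) (μ : Measure Ω) (_ : IsProbabilityMeasure μ)
        (Y : Ω → Mat n m)
        (l0 : Mat n m → Mat n m → ℝ) (gl0 : Mat n m → Mat n m → Mat n m)
        (σ μs δ ϑ : ℝ) (Bhat : Ω → Mat p m),
        (∀ y : Mat n m, IsGradientOf (fun Θ => l0 Θ y) (fun Θ => gl0 Θ y)) →
        0 < μs →
        (∀ y : Mat n m, StronglyConvexWith (fun Θ => l0 Θ y) (fun Θ => gl0 Θ y) μs) →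
        SubG μ (fun ω => -(gl0 (X * Bstar) (Y ω))) σ →
        1 < distinctRows Bstar →
        0 < δ → 1 ≤ ϑ →
        (∀ B : Mat p m,
          ((B.rank : ℝ) ≤ (1 + ϑ) * Bstar.rank) →
          ((distinctRows B : ℝ) ≤ ϑ * (distinctRows Bstar : ℝ) ^ 2) →
          δ * row2InfSq B ≤ frobSq (X * B) / n) →
        (∀ i j, Measurable fun ω => Bhat ω i j) →
        (∀ᵐ ω ∂μ,
          ((distinctRows (Bhat ω) : ℝ) ≤ ϑ * distinctRows Bstar
            ∧ ((Bhat ω).rank : ℝ) ≤ ϑ * Bstar.rank) ∧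
          ∀ B : Mat p m, ((distinctRows B : ℝ) ≤ ϑ * distinctRows Bstar) →
            (((B.rank : ℝ)) ≤ ϑ * Bstar.rank) →
            l0 (X * Bhat ω) (Y ω) ≤ l0 (X * B) (Y ω)) →
        ENNReal.ofReal (1 - C * Real.exp (-(c * ((m : ℝ) + X.rank)))) ≤
          μ {ω | row2InfSq (Bhat ω - Bstar) ≤
              (c₀ * ϑ ^ 2 * σ ^ 2 / ((n : ℝ) * δ * μs ^ 2)) *
                (((min (distinctRows Bstar) X.rank + m : ℕ) : ℝ) * Bstar.rank
                  + ((p : ℝ) - distinctRows Bstar) * Real.log (distinctRows Bstar))} := by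
  classical
  refine ⟨3328, 1 / 2, 2, by norm_num, by norm_num, by norm_num, ?_⟩
  intro n m p X Bstar Ω _ μ _ Y l0 gl0 σ μs δ ϑ Bhat _ hμs hsc hsub hq hδ hϑ hRE _ hmin
  set q := distinctRows Bstar with hqdef
  set r := Bstar.rank with hrdef
  set L : ℝ := ((min q X.rank + m : ℕ) : ℝ) * r + ((p : ℝ) - q) * Real.log q with hL
  have hqp : q ≤ p := distinctRows_le Bstar
  have hϑ0 : 0 < ϑ := by linarith
  have hr : 1 ≤ r := by
    by_contra hcon
    have h0 : r = 0 := by omega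
    have hz : Bstar = 0 := by
      rw [hrdef, Matrix.rank, Submodule.finrank_eq_zero, LinearMap.range_eq_bot] at h0
      ext i j
      have := congrFun (LinearMap.congr_fun h0 (Pi.single j 1)) i
      simpa using this
    have hle : distinctRows Bstar ≤ 1 := by
      rw [distinctRows, Set.ncard_le_one (Set.finite_range _)]
      rintro _ ⟨i, rfl⟩ _ ⟨j, rfl⟩
      simp only [hz]; rfl
    omega
  have hm : 1 ≤ m := by
    have := Matrix.rank_le_width Bstar
    omega
  have hXp : X.rank ≤ p := Matrix.rank_le_width X
  have hLlow := aux_L q r X.rank p m L hq hqp hr hXp hL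
  have hLpos : 0 < L := by
    have : (1 : ℝ) ≤ m := by exact_mod_cast hm
    have : (0 : ℝ) ≤ X.rank := by positivity
    linarith
  set Q := min ⌊ϑ * q⌋₊ p with hQdef
  have hQp : Q ≤ p := min_le_right _ _
  have hqQ : q ≤ Q := by
    refine le_min (Nat.le_floor ?_) hqp
    have : (0 : ℝ) ≤ q := by positivity
    nlinarith
  have hQr : (Q : ℝ) ≤ ϑ * q := by
    have h1 : (Q : ℝ) ≤ ⌊ϑ * q⌋₊ := by exact_mod_cast min_le_left _ _
    exact h1.trans (Nat.floor_le (by positivity))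
  set R := ⌊(1 + ϑ) * r⌋₊ with hRdef
  have hRr : (R : ℝ) ≤ (1 + ϑ) * r := Nat.floor_le (by positivity)
  obtain ⟨G, hGc, hGi, hGB⟩ := aux_family p Q hQp
  obtain ⟨G', -, hGi', hGB'⟩ := aux_family p q hqp
  obtain ⟨h', hh'G, hh'⟩ := hGB' m Bstar le_rfl
  choose N hNc hNf hNb using fun h : Fin p → Fin p => aux_lowrank (m := m) (wsp X h h') R
  set D := min (Q + q) X.rank with hD
  set T := G.biUnion N with hT
  have hTc : (T.card : ℝ) ≤ Real.exp (12 * ϑ ^ 2 * L) := by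
    have h1 : T.card ≤ G.card * 5 ^ (R * (D + m)) := by
      refine Finset.card_biUnion_le.trans ?_
      rw [← smul_eq_mul]
      refine Finset.sum_le_card_nsmul _ _ _ fun h hh => (hNc h).trans ?_
      refine Nat.pow_le_pow_right (by norm_num) (Nat.mul_le_mul_left _ (Nat.add_le_add_right ?_ _))
      exact le_min (finrank_wsp_le X h h' Q q (hGi h hh) (hGi' h' hh'G)) (finrank_wsp_le_rank X h h')
    have h2 : (T.card : ℝ) ≤ (G.card : ℝ) * 5 ^ (R * (D + m)) := by exact_mod_cast h1
    exact h2.trans (aux_numeric q r X.rank p m Q R D G.card ϑ L hq hqp hϑ hqQ hQp hQr hRr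
      (min_le_left _ _) (min_le_right _ _) hGc hL)
  set M : ℝ := 13 * ϑ ^ 2 * L with hM
  have hMpos : 0 < M := by positivity
  set s : ℝ := 2 * |σ| * Real.sqrt M with hs
  have hs0 : 0 ≤ s := by positivity
  set Ev : Ω → Mat n m := fun ω => -(gl0 (X * Bstar) (Y ω)) with hEv
  -- the good event
  set S : Set Ω := {ω | row2InfSq (Bhat ω - Bstar) ≤
      (3328 * ϑ ^ 2 * σ ^ 2 / ((n : ℝ) * δ * μs ^ 2)) * L} with hS
  have hdet : ∀ ω, (((distinctRows (Bhat ω) : ℝ) ≤ ϑ * q ∧ ((Bhat ω).rank : ℝ) ≤ ϑ * r) ∧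
          ∀ B : Mat p m, ((distinctRows B : ℝ) ≤ ϑ * q) →
            (((B.rank : ℝ)) ≤ ϑ * r) →
            l0 (X * Bhat ω) (Y ω) ≤ l0 (X * B) (Y ω)) →
      (∀ A ∈ T, mip (Ev ω) A ≤ s) → ω ∈ S := by
    rintro ω ⟨⟨hd, hrk⟩, hopt⟩ hgood
    set Δ := Bhat ω - Bstar with hΔ
    have hdQ : distinctRows (Bhat ω) ≤ Q := le_min (Nat.le_floor hd) (distinctRows_le _)
    obtain ⟨h, hhG, hh⟩ := hGB m (Bhat ω) hdQ
    have hrkΔ : (Δ.rank : ℝ) ≤ (1 + ϑ) * r := by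
      have h1 : (Δ.rank : ℝ) ≤ (Bhat ω).rank + r := by exact_mod_cast rank_sub_le' (Bhat ω) Bstar
      linarith
    have hdΔ : (distinctRows Δ : ℝ) ≤ ϑ * (q : ℝ) ^ 2 := by
      have h1 : (distinctRows Δ : ℝ) ≤ (distinctRows (Bhat ω) : ℝ) * q := by
        exact_mod_cast distinctRows_sub_le (Bhat ω) Bstar
      have : (0 : ℝ) ≤ q := by positivity
      nlinarith
    have hre := hRE Δ hrkΔ hdΔ
    have hXR : (X * Δ).rank ≤ R :=
      (Matrix.rank_mul_le_right X Δ).trans (Nat.le_floor hrkΔ)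
    have hmip := hNb h (Ev ω) s (fun A hA => hgood A (Finset.mem_biUnion.2 ⟨h, hhG, hA⟩)) (X * Δ)
      (ecol_mem_wsp X h h' (Bhat ω) Bstar hh hh') hXR
    have hfeas := hopt Bstar (by
        have : (0 : ℝ) ≤ q := by positivity
        exact le_mul_of_one_le_left this hϑ) (by
        have : (0 : ℝ) ≤ r := by positivity
        exact le_mul_of_one_le_left this hϑ)
    have hconv := hsc (Y ω) (X * Bstar) (X * Bhat ω)
    have hXΔ : X * Bhat ω - X * Bstar = X * Δ := (Matrix.mul_sub X _ _).symm
    rw [hXΔ] at hconv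
    have hneg : mip (Ev ω) (X * Δ) = - mip (gl0 (X * Bstar) (Y ω)) (X * Δ) := by
      simp [hEv, mip]
    have hF := frobSq_nonneg (X * Δ)
    set a := Real.sqrt (frobSq (X * Δ)) with ha
    have ha0 : 0 ≤ a := Real.sqrt_nonneg _
    have ha2 : a ^ 2 = frobSq (X * Δ) := Real.sq_sqrt hF
    have h1 : μs * a ^ 2 / 2 ≤ 4 * s * a := by
      rw [ha2]; simp only at hconv; linarith
    have h2 : μs * a ≤ 8 * s := by
      rcases ha0.eq_or_lt with h0 | h0
      · rw [← h0]; linarith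
      · by_contra hcon
        push Not at hcon
        nlinarith
    have h3 : μs ^ 2 * a ^ 2 ≤ 64 * s ^ 2 := by
      have : 0 ≤ μs * a := by positivity
      nlinarith
    have hs2 : s ^ 2 = 52 * ϑ ^ 2 * σ ^ 2 * L := by
      rw [hs, mul_pow, mul_pow, sq_abs, Real.sq_sqrt hMpos.le, hM]; ring
    have h4 : frobSq (X * Δ) ≤ 3328 * ϑ ^ 2 * σ ^ 2 * L / μs ^ 2 := by
      rw [le_div_iff₀ (by positivity), ← ha2]
      rw [hs2] at h3
      linarith
    change row2InfSq Δ ≤ _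
    calc row2InfSq Δ ≤ frobSq (X * Δ) / n / δ := by
          rw [le_div_iff₀ hδ]; linarith
      _ ≤ (3328 * ϑ ^ 2 * σ ^ 2 * L / μs ^ 2) / n / δ := by gcongr
      _ = _ := by
          rw [div_div, div_div, div_mul_eq_mul_div]
          congr 1; ring
  have hbad : μ Sᶜ ≤ ENNReal.ofReal (2 * Real.exp (-(1 / 2 * ((m : ℝ) + X.rank)))) := by
    have h1 : μ Sᶜ ≤ μ (⋃ A ∈ T, {ω | s < mip (Ev ω) A}) := by
      refine measure_mono_ae ?_
      filter_upwards [hmin] with ω hω hωS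
      by_contra hcon
      apply hωS
      refine hdet ω hω fun A hA => ?_
      by_contra hlt
      push Not at hlt
      exact hcon (Set.mem_biUnion hA hlt)
    refine h1.trans ((measure_biUnion_finset_le _ _).trans ?_)
    have h2 : ∀ A ∈ T, μ {ω | s < mip (Ev ω) A} ≤ ENNReal.ofReal (2 * Real.exp (-M)) := by
      intro A hA
      obtain ⟨h, -, hA'⟩ := Finset.mem_biUnion.1 hA
      exact aux_tail μ Ev σ hsub A (hNf h A hA') M hMpos
    refine (Finset.sum_le_card_nsmul _ _ _ h2).trans ?_
    rw [nsmul_eq_mul, ← ENNReal.ofReal_natCast, ← ENNReal.ofReal_mul (by positivity)]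
    refine ENNReal.ofReal_le_ofReal ?_
    calc (T.card : ℝ) * (2 * Real.exp (-M))
        ≤ Real.exp (12 * ϑ ^ 2 * L) * (2 * Real.exp (-M)) := by gcongr
      _ = 2 * Real.exp (-(ϑ ^ 2 * L)) := by
          rw [mul_left_comm, ← Real.exp_add, hM]; congr 2; ring
      _ ≤ _ := by
          refine mul_le_mul_of_nonneg_left (Real.exp_le_exp.2 (neg_le_neg ?_)) (by norm_num)
          have h3 : 1 * L ≤ ϑ ^ 2 * L :=
            mul_le_mul_of_nonneg_right (one_le_pow₀ hϑ) hLpos.le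
          linarith
  have htot : (1 : ENNReal) ≤ μ S + μ Sᶜ := by
    have := measure_union_le (μ := μ) S Sᶜ
    rwa [Set.union_compl_self, measure_univ] at this
  change ENNReal.ofReal _ ≤ μ S
  rw [ENNReal.ofReal_sub _ (by positivity), ENNReal.ofReal_one]
  exact tsub_le_iff_right.2 (htot.trans (by gcongr))
end
end

section
/- Error bound for fixed points of the SV-form CRL iteration. Let l0(·;Y) be differentiable and B* = S* (V*)ᵀ with V* ∈ ℝ^{m×r} column-orthonormal and S* = B* V*, where r = rank(B*) and q = ‖B*‖_{2,C}; assume the effective noise E = −∇l0(XB*;Y) has vec(E) sub-Gaussian with mean zero and scale bounded by σ. For B̄ = (S,V) write Ḡ_ρ(B̄; B̄⁻) = l0(X S Vᵀ;Y) − [ l0(X S Vᵀ;Y) − l0(X S⁻ (V⁻)ᵀ;Y) − ⟨∇l0(X S⁻ (V⁻)ᵀ), X(S−S⁻)(V⁻)ᵀ + X S⁻ (V−V⁻)ᵀ⟩ ] + ρ_S ‖S−S⁻‖_F²/2 + ρ_V ‖V−V⁻‖_F²/2, and let (Ŝ, V̂) be a fixed point: (Ŝ,V̂) minimizes Ḡ_ρ(·;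 (Ŝ,V̂)) over {(S,V) : ‖S‖_{2,C} ≤ q, VᵀV = I}. Define d(B̄₁, B̄₂) = ½‖X(S₁−S₂)V₂ᵀ + X S₂ (V₁−V₂)ᵀ‖_F² and D_{2,ρ}(B̄₁,B̄₂) = ρ_S‖S₁−S₂‖_F²/2 + ρ_V‖V₁−V₂‖_F²/2. Then there exist universal constants K₀ and C > 0 such that: if ρ = (ρ_S, ρ_V) satisfies, for some δ > 0 and K ≥ K₀, D_{2,ρ}(B̄₁,B̄₂) ≤ 2 Δ̄(B̄₁,B̄₂) − δ d(B̄₁,B̄₂) + K σ² P_o(q,r) for all pairs B̄_i = (S_i,V_i) with ‖S_i‖_{2,C} ≤ q and V_iᵀV_i = I, where Δ̄ is the symmetrized generalized Bregman function of (S,V) ↦ l0(X S Vᵀ;Y) associated with the above linearization, then E[ d((Ŝ,V̂), (S*,V*)) ] ≤ C·((Kδ ∨ 1)/δ²)·{ σ²(q ∧ rank(X) + m) r + σ²(p − q) log q + σ² }. -/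
open MeasureTheory Matrix

noncomputable section

/-- `P_o(q,r) = (q ∧ rank X + m) r + (p - q) log q`. -/
def PoQR (p m rkX q r : ℕ) : ℝ :=
  ((min q rkX + m : ℕ) : ℝ) * r + ((p : ℝ) - q) * Real.log q

/-- SV-form surrogate
`Ḡ_ρ(B̄;B̄⁻) = l0(XS⁻V⁻ᵀ) + ⟨∇l0(XS⁻V⁻ᵀ), X(S-S⁻)(V⁻)ᵀ + XS⁻(V-V⁻)ᵀ⟩
  + ρ_S‖S-S⁻‖_F²/2 + ρ_V‖V-V⁻‖_F²/2`. -/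
def svSurr {n m p r : ℕ} (l0 : Mat n m → ℝ) (gl0 : Mat n m → Mat n m) (X : Mat n p)
    (ρS ρV : ℝ) (S : Mat p r) (V : Mat m r) (Sm : Mat p r) (Vm : Mat m r) : ℝ :=
  l0 (X * (Sm * Vmᵀ))
    + mip (gl0 (X * (Sm * Vmᵀ))) (X * ((S - Sm) * Vmᵀ) + X * (Sm * (V - Vm)ᵀ))
    + ρS * frobSq (S - Sm) / 2 + ρV * frobSq (V - Vm) / 2

/-- `d(B̄₁,B̄₂) = ½‖X(S₁-S₂)V₂ᵀ + XS₂(V₁-V₂)ᵀ‖_F²`. -/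
def svDist {n m p r : ℕ} (X : Mat n p)
    (S₁ : Mat p r) (V₁ : Mat m r) (S₂ : Mat p r) (V₂ : Mat m r) : ℝ :=
  frobSq (X * ((S₁ - S₂) * V₂ᵀ) + X * (S₂ * (V₁ - V₂)ᵀ)) / 2

/-- Generalized Bregman function of `(S,V) ↦ l0(XSVᵀ)` with gradient pair
`(Xᵀ∇l0(XSVᵀ)V, (∇l0(XSVᵀ))ᵀXS)`. -/
def svBreg {n m p r : ℕ} (l0 : Mat n m → ℝ) (gl0 : Mat n m → Mat n m) (X : Mat n p)
    (S₁ : Mat p r) (V₁ : Mat m r) (S₂ : Mat p r) (V₂ : Mat m r) : ℝ :=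
  l0 (X * (S₁ * V₁ᵀ)) - l0 (X * (S₂ * V₂ᵀ))
    - (mip (Xᵀ * gl0 (X * (S₂ * V₂ᵀ)) * V₂) (S₁ - S₂)
      + mip ((gl0 (X * (S₂ * V₂ᵀ)))ᵀ * (X * S₂)) (V₁ - V₂))

/-- Symmetrized version of `svBreg`. -/
def svSBreg {n m p r : ℕ} (l0 : Mat n m → ℝ) (gl0 : Mat n m → Mat n m) (X : Mat n p)
    (S₁ : Mat p r) (V₁ : Mat m r) (S₂ : Mat p r) (V₂ : Mat m r) : ℝ :=
  (svBreg l0 gl0 X S₁ V₁ S₂ V₂ + svBreg l0 gl0 X S₂ V₂ S₁ V₁) / 2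


lemma aux_gauss_one : ∫ x, Real.exp (x ^ 2 / 4) ∂(ProbabilityTheory.gaussianReal 0 1) = Real.sqrt 2 ∧
    Integrable (fun x => Real.exp (x ^ 2 / 4)) (ProbabilityTheory.gaussianReal 0 1) := by
  have e : ∀ x : ℝ, ProbabilityTheory.gaussianPDFReal 0 1 x * Real.exp (x ^ 2 / 4)
      = (Real.sqrt (2 * Real.pi))⁻¹ * Real.exp (-(1/4) * x ^ 2) := by
    intro x
    simp only [ProbabilityTheory.gaussianPDFReal]
    rw [mul_assoc, ← Real.exp_add]
    norm_num
    left
    ring_nf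
  constructor
  · rw [ProbabilityTheory.integral_gaussianReal_eq_integral_smul one_ne_zero]
    simp only [smul_eq_mul, e]
    rw [integral_const_mul, integral_gaussian, ← Real.sqrt_inv, ← Real.sqrt_mul (by positivity)]
    congr 1
    field_simp
    norm_num
  · rw [ProbabilityTheory.gaussianReal_of_var_ne_zero _ one_ne_zero]
    rw [integrable_withDensity_iff_integrable_smul' (ProbabilityTheory.measurable_gaussianPDF 0 1)
      (by simp [ProbabilityTheory.gaussianPDF])]
    simp only [ProbabilityTheory.toReal_gaussianPDF, smul_eq_mul, e]
    exact (integrable_exp_neg_mul_sq (by norm_num)).const_mul _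

lemma aux_gauss {Ω : Type*} [MeasurableSpace Ω] (μ : Measure Ω) [IsProbabilityMeasure μ]
    (D : ℕ) (z : Fin D → Ω → ℝ) (hz : ∀ i, AEMeasurable (z i) μ)
    (h : ∀ g : Fin D → ℝ, ∫⁻ ω, ENNReal.ofReal (Real.exp (∑ i, g i * z i ω)) ∂μ ≤
      ENNReal.ofReal (2 * Real.exp ((∑ i, g i ^ 2) / 4))) :
    ∫⁻ ω, ENNReal.ofReal (Real.exp ((∑ i, z i ω ^ 2) / 2)) ∂μ ≤
      ENNReal.ofReal (2 * Real.sqrt 2 ^ D) := by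
  set γ : Measure (Fin D → ℝ) := Measure.pi fun _ => ProbabilityTheory.gaussianReal 0 1 with hγ
  have h1 : ∀ ω, ENNReal.ofReal (Real.exp ((∑ i, z i ω ^ 2) / 2)) =
      ∫⁻ g, ENNReal.ofReal (Real.exp (∑ i, g i * z i ω)) ∂γ := by
    intro ω
    simp only [Real.exp_sum]
    rw [← ofReal_integral_eq_lintegral_ofReal]
    · rw [integral_fintype_prod_eq_prod (fun i x => Real.exp (x * z i ω)), Finset.sum_div, Real.exp_sum]
      congr 1
      refine Finset.prod_congr rfl fun i _ => ?_
      have := congrFun (ProbabilityTheory.mgf_id_gaussianReal (μ := 0) (v := 1)) (z i ω)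
      simp only [ProbabilityTheory.mgf, id] at this
      simp only [mul_comm _ (z i ω), this]
      simp
    · refine Integrable.fintype_prod (f := fun i x => Real.exp (x * z i ω)) fun i => ?_
      simpa only [mul_comm] using ProbabilityTheory.integrable_exp_mul_gaussianReal (μ := 0) (v := 1) (z i ω)
    · exact Filter.Eventually.of_forall fun g => by positivity
  simp only [h1]
  rw [lintegral_lintegral_swap]
  · refine (lintegral_mono h).trans ?_
    simp only [Finset.sum_div, Real.exp_sum]
    rw [← ofReal_integral_eq_lintegral_ofReal]
    · rw [integral_const_mul, integral_fintype_prod_eq_prod (fun (i : Fin D) (x : ℝ) => Real.exp (x ^ 2 / 4))]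
      simp [aux_gauss_one.1]
    · exact (Integrable.fintype_prod (f := fun (i : Fin D) (x : ℝ) => Real.exp (x ^ 2 / 4))
        fun i => aux_gauss_one.2).const_mul _
    · exact Filter.Eventually.of_forall fun g => by positivity
  · simp only [Function.uncurry_def]
    refine ENNReal.measurable_ofReal.comp_aemeasurable (Real.measurable_exp.comp_aemeasurable ?_)
    refine Finset.aemeasurable_fun_sum _ fun i _ => ?_
    refine AEMeasurable.mul (by fun_prop) ?_
    exact (hz i).comp_fst

lemma aux_choose_s9 (p q : ℕ) (h : q ≤ p) (h2 : 2 ≤ q) :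
    p.choose q * q ^ (p - q) ≤ q ^ (3 * (p - q)) := by
  obtain ⟨k, rfl⟩ := Nat.exists_eq_add_of_le h
  have e : q + k - q = k := by omega
  rw [e, show 3 * k = 2 * k + k by ring, pow_add]
  refine Nat.mul_le_mul_right _ ?_
  rw [pow_mul]
  by_cases hk : k ≤ q
  · rw [Nat.choose_symm_add]
    refine (Nat.choose_le_pow _ _).trans (Nat.pow_le_pow_left ?_ _)
    nlinarith
  · refine (Nat.choose_le_two_pow _ _).trans ?_
    calc 2 ^ (q + k) ≤ 2 ^ (2 * k) := Nat.pow_le_pow_right (by norm_num) (by omega)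
      _ = (2 ^ 2) ^ k := pow_mul _ _ _
      _ ≤ _ := Nat.pow_le_pow_left (Nat.pow_le_pow_left h2 _) _

lemma aux_cover (p q : ℕ) (h : q ≤ p) (h0 : q = 0 → p = 0) (β : Type) :
    ∃ T : Finset (Fin p → Fin q), (T.card ≤ q ^ (3 * (p - q)) ∧ 0 < T.card) ∧
      ∀ S : Fin p → β, (Set.range S).ncard ≤ q → ∃ f ∈ T, ∃ N : Fin q → β, ∀ i, S i = N (f i) := by
  classical
  rcases Nat.lt_trichotomy q 1 with hq | hq | hq
  · have hq : q = 0 := by omega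
    have hp := h0 hq
    subst hq; subst hp
    exact ⟨{id}, by simp, fun S _ => ⟨id, by simp, S, fun i => rfl⟩⟩
  · subst hq
    refine ⟨{fun _ => 0}, by simp, fun S hS => ⟨fun _ => 0, by simp, fun _ => S ⟨0, h⟩, fun i => ?_⟩⟩
    have := (Set.ncard_le_one (Set.finite_range S)).1 hS
    exact this _ ⟨i, rfl⟩ _ ⟨_, rfl⟩
  · have e : ∀ R : {R : Finset (Fin p) // R ∈ Finset.powersetCard q Finset.univ},
        Nonempty ({x // x ∈ R.1} ≃ Fin q) := fun R =>
      ⟨Fintype.equivFinOfCardEq (by simpa using (Finset.mem_powersetCard.1 R.2).2)⟩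
    let E := fun R => (e R).some
    let I := Σ R : {R : Finset (Fin p) // R ∈ Finset.powersetCard q Finset.univ},
        ({x // x ∈ R.1ᶜ} → {x // x ∈ R.1})
    let F : I → (Fin p → Fin q) := fun x i =>
      if hi : i ∈ x.1.1 then E x.1 ⟨i, hi⟩ else E x.1 (x.2 ⟨i, by simpa using hi⟩)
    have key : ∀ S : Fin p → β, (Set.range S).ncard ≤ q →
        ∃ f ∈ Finset.univ.image F, ∃ N : Fin q → β, ∀ i, S i = N (f i) := by
      intro S hS
      have : ∀ y : Set.range S, ∃ i, S i = y := fun y => y.2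
      choose c hc using this
      let R0 : Finset (Fin p) := Finset.univ.image fun i => c ⟨S i, i, rfl⟩
      have hR0 : R0.card ≤ q := by
        refine le_trans ?_ hS
        have : R0 ⊆ (Finset.univ.image c) := by
          intro x hx
          simp only [R0, Finset.mem_image, Finset.mem_univ, true_and] at hx ⊢
          obtain ⟨i, hi⟩ := hx
          exact ⟨_, hi⟩
        refine (Finset.card_le_card this).trans (Finset.card_image_le.trans ?_)
        rw [Finset.card_univ, ← Nat.card_eq_fintype_card, Nat.card_coe_set_eq]
      obtain ⟨R, hR, hRc⟩ := Finset.exists_superset_card_eq hR0 (by simpa using h)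
      let R' : {R : Finset (Fin p) // R ∈ Finset.powersetCard q Finset.univ} :=
        ⟨R, by simp [Finset.mem_powersetCard, hRc]⟩
      let x : I := ⟨R', fun i => ⟨c ⟨S i, i, rfl⟩, hR (by simp [R0])⟩⟩
      refine ⟨F x, by simp, fun j => S ((E R').symm j), fun i => ?_⟩
      by_cases hi : i ∈ R
      · have : F x i = E R' ⟨i, hi⟩ := dif_pos hi
        rw [this]; simp
      · have : F x i = E R' (x.2 ⟨i, by simpa using hi⟩) := dif_neg hi
        rw [this]; simp [x, hc]
    have hx0 : (Finset.univ.image F).Nonempty := by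
      have : Nonempty I := by
        obtain ⟨R, hR, hRc⟩ := Finset.exists_subset_card_eq (s := (Finset.univ : Finset (Fin p))) (n := q) (by simpa using h)
        have : Nonempty {x // x ∈ R} := (Finset.card_pos.1 (by omega)).to_subtype
        exact ⟨⟨⟨R, by simp [Finset.mem_powersetCard, hRc]⟩, fun _ => this.some⟩⟩
      exact Finset.univ_nonempty.image _
    refine ⟨Finset.univ.image F, ⟨?_, Finset.card_pos.2 hx0⟩, key⟩
    refine Finset.card_image_le.trans ?_
    refine le_trans (le_of_eq ?_) (aux_choose_s9 p q h hq)
    rw [Finset.card_univ, Fintype.card_sigma]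
    rw [Finset.sum_congr rfl (g := fun _ => q ^ (p - q))]
    · simp
    · intro R _
      have := (Finset.mem_powersetCard.1 R.2).2
      simp [this]

lemma aux_mip_add {k l : ℕ} (A B C : Mat k l) : mip A (B + C) = mip A B + mip A C := by
  simp [mip, mul_add, Finset.sum_add_distrib]

lemma aux_mip_neg {k l : ℕ} (A B : Mat k l) : mip (-A) B = - mip A B := by
  simp [mip]

lemma aux_mip_neg_right {k l : ℕ} (A B : Mat k l) : mip A (-B) = - mip A B := by
  simp [mip]

lemma aux_mip_smul {k l : ℕ} (A B : Mat k l) (c : ℝ) : mip A (c • B) = c * mip A B := by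
  simp only [mip, Finset.mul_sum, Matrix.smul_apply, smul_eq_mul]
  refine Finset.sum_congr rfl fun i _ => Finset.sum_congr rfl fun j _ => by ring

lemma aux_frobSq_nonneg {k l : ℕ} (A : Mat k l) : 0 ≤ frobSq A := by
  unfold frobSq mip
  exact Finset.sum_nonneg fun _ _ => Finset.sum_nonneg fun _ _ => mul_self_nonneg _

lemma aux_frobSq_zero {k l : ℕ} (A : Mat k l) (h : frobSq A = 0) : A = 0 := by
  unfold frobSq mip at h
  ext i j
  have h1 := (Finset.sum_eq_zero_iff_of_nonneg
    (fun _ _ => Finset.sum_nonneg fun _ _ => mul_self_nonneg _)).1 h i (Finset.mem_univ _)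
  have h2 := (Finset.sum_eq_zero_iff_of_nonneg (fun _ _ => mul_self_nonneg _)).1 h1 j (Finset.mem_univ _)
  simpa using h2

lemma aux_mip_trace {k l : ℕ} (A B : Mat k l) : mip A B = (Aᵀ * B).trace := by
  simp only [mip, Matrix.trace, Matrix.diag, Matrix.mul_apply, Matrix.transpose_apply]
  exact Finset.sum_comm

lemma aux_grad1 {n m p r : ℕ} (X : Mat n p) (G : Mat n m) (V : Mat m r) (D : Mat p r) :
    mip (Xᵀ * G * V) D = mip G (X * (D * Vᵀ)) := by
  rw [aux_mip_trace, aux_mip_trace]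
  simp only [Matrix.transpose_mul, Matrix.transpose_transpose]
  rw [Matrix.mul_assoc, Matrix.trace_mul_comm]
  simp only [Matrix.mul_assoc]

lemma aux_grad2 {n m p r : ℕ} (X : Mat n p) (G : Mat n m) (S : Mat p r) (D : Mat m r) :
    mip (Gᵀ * (X * S)) D = mip G (X * (S * Dᵀ)) := by
  rw [aux_mip_trace, aux_mip_trace, ← Matrix.trace_transpose (Gᵀ * _)]
  simp only [Matrix.transpose_mul, Matrix.transpose_transpose]
  rw [Matrix.trace_mul_comm]
  simp only [Matrix.mul_assoc]

/-- Deterministic basic inequality. -/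
lemma aux_basic {n m p r : ℕ} (X : Mat n p) (l0 : Mat n m → ℝ) (gl0 : Mat n m → Mat n m)
    (ρS ρV δ c : ℝ) (S S' : Mat p r) (V V' : Mat m r)
    (h1 : ρS * frobSq (S - S') / 2 + ρV * frobSq (V - V') / 2 ≤
            2 * svSBreg l0 gl0 X S V S' V' - δ * svDist X S V S' V' + c)
    (h2 : svSurr l0 gl0 X ρS ρV S V S V ≤ svSurr l0 gl0 X ρS ρV S' V' S V) :
    δ * svDist X S V S' V' ≤ mip (-(gl0 (X * (S' * V'ᵀ))))
      (X * ((S - S') * V'ᵀ) + X * (S' * (V - V')ᵀ)) + c := by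
  have e0 : ∀ {k l : ℕ} (A B : Mat k l), frobSq (A - B) = frobSq (B - A) := by
    intro k l A B
    simp only [frobSq, mip, Matrix.sub_apply]
    refine Finset.sum_congr rfl fun i _ => Finset.sum_congr rfl fun j _ => by ring
  have e1 : X * ((S' - S) * Vᵀ) = -(X * ((S - S') * Vᵀ)) := by
    rw [← neg_sub S S', Matrix.neg_mul, Matrix.mul_neg]
  have e2 : X * (S * (V' - V)ᵀ) = -(X * (S * (V - V')ᵀ)) := by
    rw [← neg_sub V V', Matrix.transpose_neg, Matrix.mul_neg, Matrix.mul_neg]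
  have z1 : ∀ {k l : ℕ}, frobSq (0 : Mat k l) = 0 := by intro k l; simp [frobSq, mip]
  have z2 : ∀ {k l : ℕ} (A : Mat k l), mip A 0 = 0 := by intro k l A; simp [mip]
  simp only [svSBreg, svBreg, aux_grad1, aux_grad2] at h1
  simp only [svSurr, sub_self, z1, Matrix.zero_mul, Matrix.mul_zero, Matrix.transpose_zero,
    add_zero, z2, aux_mip_add, e1, e2, aux_mip_neg_right, e0 S' S, e0 V' V] at h2
  simp only [e1, e2, aux_mip_neg_right] at h1
  rw [aux_mip_neg, aux_mip_add]
  linarith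

lemma aux_mgf {Ω : Type*} [MeasurableSpace Ω] (μ : Measure Ω) [IsProbabilityMeasure μ] {k l : ℕ}
    (E : Ω → Mat k l) (σ s : ℝ) (hE : SubG μ E σ) (hs : |σ| < s) (B : Mat k l) :
    ∫⁻ ω, ENNReal.ofReal (Real.exp (mip (E ω) B)) ∂μ ≤
      ENNReal.ofReal (2 * Real.exp (s ^ 2 * frobSq B / 4)) := by
  rcases (aux_frobSq_nonneg B).eq_or_lt with h0 | h0
  · have := aux_frobSq_zero B h0.symm
    subst this
    rw [← h0]
    have z2 : ∀ {k l : ℕ} (A : Mat k l), mip A 0 = 0 := by intro k l A; simp [mip]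
    simp [z2]
  · have hr := Real.sqrt_pos.2 h0
    have hs0 : 0 < s := (abs_nonneg _).trans_lt hs
    have hst : σ * Real.sqrt (frobSq B) < s * Real.sqrt (frobSq B) :=
      mul_lt_mul_of_pos_right ((le_abs_self _).trans_lt hs) hr
    have h2 := hE.2 B _ hst
    set t := s * Real.sqrt (frobSq B) with ht
    have ht0 : 0 < t := by positivity
    have htt : s ^ 2 * frobSq B = t ^ 2 := by rw [ht, mul_pow, Real.sq_sqrt h0.le]
    rw [htt]
    have : ∀ ω, ENNReal.ofReal (Real.exp (mip (E ω) B)) ≤ ENNReal.ofReal (Real.exp (t ^ 2 / 4)) *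
        ENNReal.ofReal (Real.exp ((mip (E ω) B / t) ^ 2)) := by
      intro ω
      rw [← ENNReal.ofReal_mul (by positivity), ← Real.exp_add]
      refine ENNReal.ofReal_le_ofReal (Real.exp_le_exp.2 ?_)
      set x := mip (E ω) B
      have hx : x = x / t * t := by field_simp
      nlinarith [sq_nonneg (x / t - t / 2)]
    refine (lintegral_mono this).trans ?_
    rw [lintegral_const_mul' _ _ ENNReal.ofReal_ne_top, mul_comm 2, ENNReal.ofReal_mul (by positivity)]
    gcongr
    simpa using h2

/-- Embedding of matrices in Euclidean space. -/
def auxΦ (k l : ℕ) : Mat k l →ₗ[ℝ] EuclideanSpace ℝ (Fin k × Fin l) where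
  toFun A := WithLp.toLp 2 fun ij => A ij.1 ij.2
  map_add' A B := by ext; simp
  map_smul' c A := by ext; simp

lemma aux_inner {k l : ℕ} (A B : Mat k l) : inner ℝ (auxΦ k l A) (auxΦ k l B) = mip A B := by
  simp only [auxΦ, LinearMap.coe_mk, AddHom.coe_mk, PiLp.inner_apply, mip, Fintype.sum_prod_type]
  simp [mul_comm]

lemma aux_sub {Ω : Type*} [MeasurableSpace Ω] (μ : Measure Ω) [IsProbabilityMeasure μ] {k l : ℕ}
    (E : Ω → Mat k l) (σ s : ℝ) (hE : SubG μ E σ) (hs : |σ| < s) (W : Submodule ℝ (Mat k l))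
    (D : ℕ) (hD : Module.finrank ℝ W ≤ D) :
    ∃ Q : Ω → ℝ, AEMeasurable Q μ ∧
      ∫⁻ ω, ENNReal.ofReal (Real.exp (Q ω / 2)) ∂μ ≤ ENNReal.ofReal (2 * Real.sqrt 2 ^ D) ∧
      ∀ ω, ∀ a ∈ W, mip (E ω) a ^ 2 ≤ s ^ 2 * Q ω * frobSq a := by
  have hs0 : 0 < s := (abs_nonneg _).trans_lt hs
  let W' := W.map (auxΦ k l)
  let b := stdOrthonormalBasis ℝ W'
  have hb : ∀ i, ∃ A, auxΦ k l A = (b i : EuclideanSpace ℝ (Fin k × Fin l)) := fun i => by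
    obtain ⟨A, _, hA⟩ := (b i).2
    exact ⟨A, hA⟩
  choose A hA using hb
  let z : Fin (Module.finrank ℝ W') → Ω → ℝ := fun i ω => s⁻¹ * mip (E ω) (A i)
  have hz : ∀ i, AEMeasurable (z i) μ := fun i => ((hE.1 (A i)).1.aemeasurable).const_mul _
  refine ⟨fun ω => ∑ i, z i ω ^ 2, Finset.aemeasurable_fun_sum _ fun i _ => (hz i).pow_const 2, ?_, ?_⟩
  · have hf : Module.finrank ℝ W' ≤ D := (Submodule.finrank_map_le _ _).trans hD
    refine (aux_gauss μ _ z hz ?_).trans ?_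
    · intro g
      let B : Mat k l := s⁻¹ • ∑ i, g i • A i
      have hB1 : ∀ ω, ∑ i, g i * z i ω = mip (E ω) B := by
        intro ω
        simp only [B, z]
        rw [← aux_inner]
        simp only [map_smul, map_sum, inner_smul_right, inner_sum, aux_inner, Finset.mul_sum]
        refine Finset.sum_congr rfl fun i _ => by ring
      have hB2 : s ^ 2 * frobSq B = ∑ i, g i ^ 2 := by
        have e : auxΦ k l B = s⁻¹ • ((∑ i, g i • b i : W') : EuclideanSpace ℝ (Fin k × Fin l)) := by
          simp only [B, map_smul, map_sum, hA, Submodule.coe_sum, Submodule.coe_smul]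
        rw [frobSq, ← aux_inner, e, inner_smul_left, inner_smul_right, ← Submodule.coe_inner,
          b.orthonormal.inner_sum]
        simp only [conj_trivial, ← sq]
        field_simp
      simp only [hB1, ← hB2]
      exact aux_mgf μ E σ s hE hs B
    · refine ENNReal.ofReal_le_ofReal ?_
      gcongr
      exact Real.one_le_sqrt.2 (by norm_num)
  · intro ω a ha
    let a' : W' := ⟨auxΦ k l a, a, ha, rfl⟩
    have e1 : mip (E ω) a = ∑ i, inner ℝ (b i) a' * mip (E ω) (A i) := by
      have h1 : auxΦ k l a = ((∑ i, inner ℝ (b i) a' • b i : W') : EuclideanSpace ℝ (Fin k × Fin l)) := by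
        rw [b.sum_repr']
      rw [← aux_inner, h1]
      simp only [Submodule.coe_sum, Submodule.coe_smul, inner_sum, inner_smul_right, ← hA, aux_inner]
    have e2 : frobSq a = ∑ i, inner ℝ (b i) a' ^ 2 := by
      rw [frobSq, ← aux_inner]
      have := b.sum_sq_inner_right a'
      rw [this, ← real_inner_self_eq_norm_sq]
      rfl
    rw [e1, e2]
    refine (Finset.sum_mul_sq_le_sq_mul_sq _ _ _).trans (le_of_eq ?_)
    simp only [z, mul_pow, ← Finset.mul_sum]
    field_simp

/-- the error matrix lies in a low-dimensional space -/
def auxL {n m r : ℕ} (U : Submodule ℝ (Fin n → ℝ)) (Vs : Mat m r) (XS : Mat n r) :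
    ((Fin r → U) × Mat m r) →ₗ[ℝ] Mat n m where
  toFun x := (Matrix.of fun i j => (x.1 j : Fin n → ℝ) i : Mat n r) * Vsᵀ + XS * x.2ᵀ
  map_add' x y := by
    have : (Matrix.of fun i j => ((x + y).1 j : Fin n → ℝ) i : Mat n r) =
      (Matrix.of fun i j => (x.1 j : Fin n → ℝ) i : Mat n r) +
      (Matrix.of fun i j => (y.1 j : Fin n → ℝ) i : Mat n r) := by ext; simp
    rw [this, Prod.snd_add, Matrix.transpose_add, Matrix.add_mul, Matrix.mul_add]
    abel
  map_smul' c x := by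
    have : (Matrix.of fun i j => ((c • x).1 j : Fin n → ℝ) i : Mat n r) =
      c • (Matrix.of fun i j => (x.1 j : Fin n → ℝ) i : Mat n r) := by ext; simp
    rw [this, Prod.smul_snd, Matrix.transpose_smul, Matrix.smul_mul, Matrix.mul_smul]
    simp

lemma aux_dim {n m p q r : ℕ} (X : Mat n p) (P : Mat p q) (Vs : Mat m r) (XS : Mat n r) :
    Module.finrank ℝ (LinearMap.range (auxL (LinearMap.range (X * P).mulVecLin) Vs XS)) ≤
      (min q X.rank + m) * r := by
  refine (LinearMap.finrank_range_le _).trans ?_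
  rw [Module.finrank_prod, Module.finrank_pi_fintype, Module.finrank_matrix]
  simp only [Finset.sum_const, Finset.card_univ, Fintype.card_fin, smul_eq_mul, Module.finrank_self]
  have h : Module.finrank ℝ (LinearMap.range (X * P).mulVecLin) ≤ min q X.rank :=
    le_min (Matrix.rank_le_width (X * P)) (Matrix.rank_mul_le_left X P)
  nlinarith [Nat.mul_le_mul_left r h]

lemma aux_mem {n m p q r : ℕ} (X : Mat n p) (f : Fin p → Fin q) (N : Mat q r) (S Ss : Mat p r)
    (V Vs : Mat m r) (hS : ∀ i, S i = N (f i)) :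
    X * ((S - Ss) * Vsᵀ) + X * (Ss * (V - Vs)ᵀ) ∈
      LinearMap.range (auxL (LinearMap.range
        (X * (Matrix.of fun i j => if f i = j then 1 else 0 : Mat p q)).mulVecLin) Vs (X * Ss)) := by
  set P : Mat p q := Matrix.of fun i j => if f i = j then 1 else 0 with hP
  have hSP : S = P * N := by
    ext i j
    simp [hP, Matrix.mul_apply, hS]
  refine ⟨(fun j => ⟨(X * P) *ᵥ (fun k => N k j), _, rfl⟩, V - 2 • Vs), ?_⟩
  have e : (Matrix.of fun i j => ((X * P) *ᵥ (fun k => N k j)) i : Mat n r) = X * S := by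
    rw [hSP, ← Matrix.mul_assoc]
    ext i j
    rfl
  simp only [auxL, LinearMap.coe_mk, AddHom.coe_mk, e]
  simp only [Matrix.transpose_sub, Matrix.mul_sub, Matrix.sub_mul, Matrix.transpose_smul,
    Matrix.mul_smul, Matrix.mul_assoc]
  rw [two_smul]
  abel

lemma aux_num (δ s R x a c : ℝ) (hδ : 0 < δ) (ha : 0 ≤ a) (hRp : 0 ≤ R)
    (hm2 : x ^ 2 ≤ (2 * s ^ 2 * R) * a) (hb : δ * (a / 2) ≤ x + c) :
    a / 2 ≤ 4 * s ^ 2 / δ ^ 2 * R + 2 * c / δ := by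
  have hx2 : x ≤ δ * a / 4 + 2 * s ^ 2 * R / δ := by
    rcases ha.eq_or_lt with h0 | h0
    · rw [← h0] at hm2 ⊢
      have hx0 : x = 0 := by nlinarith
      rw [hx0]
      positivity
    · have h8 : x ^ 2 / a ≤ 2 * s ^ 2 * R := by
        rw [div_le_iff₀ h0]; exact hm2
      have h9 : x ≤ δ * a / 4 + x ^ 2 / a / δ := by
        have : δ * a / 4 + x ^ 2 / a / δ - x = (x - δ * a / 2) ^ 2 / (a * δ) := by
          field_simp; ring
        have h10 : 0 ≤ (x - δ * a / 2) ^ 2 / (a * δ) := by positivity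
        linarith
      have : x ^ 2 / a / δ ≤ 2 * s ^ 2 * R / δ := by gcongr
      linarith
  have : a / 4 ≤ (2 * s ^ 2 * R / δ + c) / δ := by
    rw [le_div_iff₀ hδ]; linarith
  have e : 4 * s ^ 2 / δ ^ 2 * R + 2 * c / δ = 2 * ((2 * s ^ 2 * R / δ + c) / δ) := by
    field_simp; ring
  rw [e]; linarith

lemma aux_final (δ σ K P : ℝ) (hδ : 0 < δ) (hP0 : 0 ≤ P) :
    4 * |σ| ^ 2 / δ ^ 2 * (3 * P + 2) + 2 * (K * σ ^ 2 * P) / δ ≤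
      14 * (max (K * δ) 1 / δ ^ 2) * (σ ^ 2 * (P + 1)) := by
  rw [sq_abs]
  have e : 4 * σ ^ 2 / δ ^ 2 * (3 * P + 2) + 2 * (K * σ ^ 2 * P) / δ =
    (4 * (3 * P + 2) + 2 * (K * δ) * P) * (σ ^ 2 / δ ^ 2) := by field_simp
  have e' : 14 * (max (K * δ) 1 / δ ^ 2) * (σ ^ 2 * (P + 1)) =
    (14 * max (K * δ) 1 * (P + 1)) * (σ ^ 2 / δ ^ 2) := by field_simp
  rw [e, e']
  refine mul_le_mul_of_nonneg_right ?_ (by positivity)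
  have m1 := le_max_left (K * δ) 1
  have m2 := le_max_right (K * δ) 1
  nlinarith [mul_le_mul_of_nonneg_right m1 hP0, mul_le_mul_of_nonneg_right m2 hP0]

/-- **Error bound for fixed points of the SV-form CRL iteration.** With sub-Gaussian(σ)
effective noise and stepsizes `ρ = (ρ_S, ρ_V)` obeying
`D_{2,ρ}(B̄₁,B̄₂) ≤ 2Δ̄(B̄₁,B̄₂) - δ d(B̄₁,B̄₂) + Kσ²P_o(q,r)` on the feasible set for some
`δ > 0`, `K ≥ K₀`, every almost-sure fixed point `(Ŝ,V̂)` of the SV surrogate iteration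
satisfies `E d((Ŝ,V̂),(S*,V*)) ≤ C((Kδ ∨ 1)/δ²){σ²(q ∧ rank X + m)r + σ²(p-q)log q + σ²}`. -/
theorem crl_sv_fixed_point_bound :
    ∃ K₀ C : ℝ, 0 ≤ K₀ ∧ 0 < C ∧
      ∀ (n m p r : ℕ) (X : Mat n p) (Bstar : Mat p m)
        (Sstar : Mat p r) (Vstar : Mat m r)
        (Ω : Type) (_ : MeasurableSpace Ω) (μ : Measure Ω) (_ : IsProbabilityMeasure μ)
        (Y : Ω → Mat n m)
        (l0 : Mat n m → Mat n m → ℝ) (gl0 : Mat n m → Mat n m → Mat n m)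
        (σ ρS ρV δ K : ℝ) (q : ℕ) (Shat : Ω → Mat p r) (Vhat : Ω → Mat m r),
        (∀ y : Mat n m, IsGradientOf (fun Θ => l0 Θ y) (fun Θ => gl0 Θ y)) →
        SubG μ (fun ω => -(gl0 (X * Bstar) (Y ω))) σ →
        Bstar = Sstar * Vstarᵀ → Vstarᵀ * Vstar = 1 → Sstar = Bstar * Vstar →
        r = Bstar.rank → q = distinctRows Bstar →
        0 ≤ ρS → 0 ≤ ρV → 0 < δ → K₀ ≤ K →
        (∀ᵐ ω ∂μ, ∀ (S₁ S₂ : Mat p r) (V₁ V₂ : Mat m r),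
          distinctRows S₁ ≤ q → V₁ᵀ * V₁ = 1 → distinctRows S₂ ≤ q → V₂ᵀ * V₂ = 1 →
          ρS * frobSq (S₁ - S₂) / 2 + ρV * frobSq (V₁ - V₂) / 2 ≤
            2 * svSBreg (fun Θ => l0 Θ (Y ω)) (fun Θ => gl0 Θ (Y ω)) X S₁ V₁ S₂ V₂
              - δ * svDist X S₁ V₁ S₂ V₂ + K * σ ^ 2 * PoQR p m X.rank q r) →
        (∀ i j, Measurable fun ω => Shat ω i j) →
        (∀ i j, Measurable fun ω => Vhat ω i j) →
        (∀ᵐ ω ∂μ,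
          (distinctRows (Shat ω) ≤ q ∧ (Vhat ω)ᵀ * Vhat ω = 1) ∧
          ∀ (S : Mat p r) (V : Mat m r), distinctRows S ≤ q → Vᵀ * V = 1 →
            svSurr (fun Θ => l0 Θ (Y ω)) (fun Θ => gl0 Θ (Y ω)) X ρS ρV
                (Shat ω) (Vhat ω) (Shat ω) (Vhat ω)
              ≤ svSurr (fun Θ => l0 Θ (Y ω)) (fun Θ => gl0 Θ (Y ω)) X ρS ρV
                  S V (Shat ω) (Vhat ω)) →
        ∫ ω, svDist X (Shat ω) (Vhat ω) Sstar Vstar ∂μ ≤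
          C * (max (K * δ) 1 / δ ^ 2) *
            (σ ^ 2 * ((min q X.rank + m : ℕ) : ℝ) * r
              + σ ^ 2 * ((p : ℝ) - q) * Real.log q + σ ^ 2) := by
  refine ⟨0, 14, le_rfl, by norm_num, ?_⟩
  intro n m p r X Bstar Sstar Vstar Ω _ μ _ Y l0 gl0 σ ρS ρV δ K q Shat Vhat _ hE hB _ hS
    _ hq _ _ hδ hK hcond _ _ hfix
  have hVV : Vstarᵀ * Vstar = 1 := by assumption
  have hqp : q ≤ p := by
    rw [hq, distinctRows]
    simpa [Set.image_univ] using Set.ncard_image_le (s := Set.univ) (f := fun i => Bstar i) Set.finite_univ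
  have hq0 : q = 0 → p = 0 := by
    intro h
    rw [hq, distinctRows, Set.ncard_eq_zero (Set.finite_range _), Set.range_eq_empty_iff] at h
    by_contra hp
    exact h.false ⟨0, Nat.pos_of_ne_zero hp⟩
  have hSq : distinctRows Sstar ≤ q := by
    have : (Set.range fun i => Sstar i) = (fun v => v ᵥ* Vstar) '' (Set.range fun i => Bstar i) := by
      rw [← Set.range_comp]
      congr 1
    rw [hq, distinctRows, this]
    exact Set.ncard_image_le (Set.finite_range _)
  set L : ℝ := ((p : ℝ) - q) * Real.log q with hL
  set M : ℕ := (min q X.rank + m) * r with hM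
  have hL0 : 0 ≤ L := mul_nonneg (by simpa using hqp) (Real.log_natCast_nonneg q)
  have hP : PoQR p m X.rank q r = M + L := by
    simp only [PoQR, hM, hL]; push_cast; ring
  set P : ℝ := M + L with hPdef
  have hP0 : 0 ≤ P := by positivity
  have hrhs : σ ^ 2 * ((min q X.rank + m : ℕ) : ℝ) * r
              + σ ^ 2 * ((p : ℝ) - q) * Real.log q + σ ^ 2 = σ ^ 2 * (P + 1) := by
    simp only [hPdef, hM, hL]; push_cast; ring
  rw [hrhs]
  clear_value L
  clear_value P
  obtain ⟨T, ⟨hT1, hT0⟩, hT⟩ := aux_cover p q hqp hq0 (Fin r → ℝ)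
  have hlogT : Real.log (T.card : ℝ) ≤ 3 * L := by
    refine (Real.log_le_log (by exact_mod_cast hT0) (Nat.cast_le.2 hT1)).trans (le_of_eq ?_)
    push_cast
    rw [Real.log_pow]
    rw [hL]
    push_cast [Nat.cast_sub hqp]
    ring
  have main : ∀ s, |σ| < s → ∫ ω, svDist X (Shat ω) (Vhat ω) Sstar Vstar ∂μ ≤
      4 * s ^ 2 / δ ^ 2 * (3 * P + 2) + 2 * (K * σ ^ 2 * P) / δ := by
    intro s hs
    have hs0 : 0 < s := (abs_nonneg _).trans_lt hs
    choose Q hQm hQi hQ using fun f : Fin p → Fin q => aux_sub μ _ σ s hE hs _ M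
      (aux_dim X (Matrix.of fun i j => if f i = j then 1 else 0 : Mat p q) Vstar (X * Sstar))
    have hQint : ∀ f, Integrable (fun ω => Real.exp (Q f ω / 2)) μ := by
      intro f
      refine ⟨(Real.measurable_exp.comp_aemeasurable ((hQm f).div_const 2)).aestronglyMeasurable, ?_⟩
      rw [hasFiniteIntegral_iff_ofReal (Filter.Eventually.of_forall fun _ => (Real.exp_pos _).le)]
      exact (hQi f).trans_lt ENNReal.ofReal_lt_top
    have hQintle : ∀ f, ∫ ω, Real.exp (Q f ω / 2) ∂μ ≤ 2 * Real.sqrt 2 ^ M := by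
      intro f
      rw [integral_eq_lintegral_of_nonneg_ae (Filter.Eventually.of_forall fun _ => (Real.exp_pos _).le)
        (hQint f).aestronglyMeasurable]
      exact ENNReal.toReal_le_of_le_ofReal (by positivity) (hQi f)
    have hTpos : (0 : ℝ) < T.card := by exact_mod_cast hT0
    obtain ⟨t, ht⟩ : ∃ t : ℝ, t = T.card := ⟨_, rfl⟩
    rw [← ht] at hTpos hlogT
    set Z : ℝ := t * (2 * Real.sqrt 2 ^ M) with hZ
    have hZ0 : 0 < Z := by positivity
    have hZ1 : 1 ≤ Z := by
      have h6 : (1 : ℝ) ≤ t := by rw [ht]; exact_mod_cast hT0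
      have h7 : (1 : ℝ) ≤ Real.sqrt 2 ^ M := one_le_pow₀ (Real.one_le_sqrt.2 (by norm_num))
      rw [hZ]; nlinarith
    clear_value Z
    set F : Ω → ℝ := fun ω => ∑ f ∈ T, Real.exp (Q f ω / 2) with hF
    have hFi : Integrable F μ := integrable_finsetSum _ fun f _ => hQint f
    have hFle : ∫ ω, F ω ∂μ ≤ Z := by
      rw [hF, integral_finsetSum _ fun f _ => hQint f]
      refine (Finset.sum_le_sum fun f _ => hQintle f).trans (le_of_eq ?_)
      rw [Finset.sum_const, nsmul_eq_mul, hZ, ht]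
    have hlogZ : Real.log Z + 1 ≤ 3 * P + 2 := by
      rw [hZ, Real.log_mul (by positivity) (by positivity), Real.log_mul (by norm_num) (by positivity),
        Real.log_pow, Real.log_sqrt (by norm_num)]
      have h2 : Real.log 2 ≤ 1 := by linarith [Real.log_two_lt_d9]
      have : (M : ℝ) * (Real.log 2 / 2) ≤ M * 1 := by gcongr; linarith
      have hM0 : (0 : ℝ) ≤ M := Nat.cast_nonneg _
      linarith
    have hae : ∀ᵐ ω ∂μ, svDist X (Shat ω) (Vhat ω) Sstar Vstar ≤
        4 * s ^ 2 / δ ^ 2 * (Real.log Z + Z⁻¹ * F ω) + 2 * (K * σ ^ 2 * P) / δ := by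
      filter_upwards [hcond, hfix] with ω h1 h2
      have hb := aux_basic X _ _ ρS ρV δ _ _ _ _ _
        (h1 (Shat ω) Sstar (Vhat ω) Vstar h2.1.1 h2.1.2 hSq hVV) (h2.2 Sstar Vstar hSq hVV)
      rw [hP, ← hB] at hb
      obtain ⟨f, hfT, N, hN⟩ := hT (fun i => Shat ω i) h2.1.1
      have hm := hQ f ω _ (aux_mem X f N (Shat ω) Sstar (Vhat ω) Vstar hN)
      have hQb : Q f ω / 2 ≤ Real.log Z + Z⁻¹ * F ω := by
        have h3 : Real.exp (Q f ω / 2) ≤ F ω :=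
          Finset.single_le_sum (f := fun f => Real.exp (Q f ω / 2))
            (fun f _ => (Real.exp_pos _).le) hfT
        have h4 : Q f ω / 2 - Real.log Z ≤ Real.exp (Q f ω / 2 - Real.log Z) := by
          linarith [Real.add_one_le_exp (Q f ω / 2 - Real.log Z)]
        rw [Real.exp_sub, Real.exp_log hZ0] at h4
        have h5 : Real.exp (Q f ω / 2) / Z ≤ Z⁻¹ * F ω := by
          rw [div_eq_inv_mul]; gcongr
        linarith
      rw [svDist] at hb ⊢
      set A := X * ((Shat ω - Sstar) * Vstarᵀ) + X * (Sstar * (Vhat ω - Vstar)ᵀ) with hA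
      set x := mip (-(gl0 (X * Bstar) (Y ω))) A with hx
      have ha := aux_frobSq_nonneg A
      set a := frobSq A with haa
      set R := Real.log Z + Z⁻¹ * F ω with hR
      have hF0 : 0 ≤ F ω := Finset.sum_nonneg fun f _ => (Real.exp_pos _).le
      have hRp : 0 ≤ R := add_nonneg (Real.log_nonneg hZ1) (mul_nonneg (inv_nonneg.2 hZ0.le) hF0)
      have hm2 : x ^ 2 ≤ (2 * s ^ 2 * R) * a := by
        refine hm.trans ?_
        refine mul_le_mul_of_nonneg_right ?_ ha
        nlinarith [sq_nonneg s]
      exact aux_num δ s R x a (K * σ ^ 2 * P) hδ ha hRp hm2 hb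
    have hR1 : Integrable (fun ω => Z⁻¹ * F ω) μ := hFi.const_mul _
    have hR2 : Integrable (fun ω => Real.log Z + Z⁻¹ * F ω) μ := (integrable_const _).add hR1
    have hR3 : Integrable (fun ω => 4 * s ^ 2 / δ ^ 2 * (Real.log Z + Z⁻¹ * F ω)) μ := hR2.const_mul _
    have hRi : Integrable (fun ω => 4 * s ^ 2 / δ ^ 2 * (Real.log Z + Z⁻¹ * F ω)
        + 2 * (K * σ ^ 2 * P) / δ) μ :=
      hR3.add (integrable_const _)
    refine (integral_mono_of_nonneg (Filter.Eventually.of_forall fun ω => ?_) hRi hae).trans ?_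
    · exact div_nonneg (aux_frobSq_nonneg _) (by norm_num)
    · rw [integral_add hR3 (integrable_const _),
        integral_const_mul, integral_add (integrable_const _) hR1, integral_const_mul]
      simp only [integral_const, probReal_univ, one_smul]
      have : Z⁻¹ * ∫ ω, F ω ∂μ ≤ 1 := by
        rw [inv_mul_le_iff₀ hZ0]; linarith
      have h11 := mul_le_mul_of_nonneg_left (show Real.log Z + Z⁻¹ * ∫ ω, F ω ∂μ ≤ 3 * P + 2 by linarith)
        (show (0 : ℝ) ≤ 4 * s ^ 2 / δ ^ 2 by positivity)
      linarith
  have hlim : ∫ ω, svDist X (Shat ω) (Vhat ω) Sstar Vstar ∂μ ≤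
      4 * |σ| ^ 2 / δ ^ 2 * (3 * P + 2) + 2 * (K * σ ^ 2 * P) / δ := by
    have hc : Continuous fun s : ℝ => 4 * s ^ 2 / δ ^ 2 * (3 * P + 2) + 2 * (K * σ ^ 2 * P) / δ := by
      fun_prop
    refine ge_of_tendsto (hc.continuousAt.tendsto.mono_left nhdsWithin_le_nhds :
      Filter.Tendsto _ (nhdsWithin |σ| (Set.Ioi |σ|)) _) ?_
    filter_upwards [self_mem_nhdsWithin] with s hs using main s hs
  exact hlim.trans (aux_final δ σ K P hδ hP0)
end
end
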